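/- Under the standard assumptions, suppose H_a and H_b are any Kuratowski subgraphs of G avoiding a and b respectively. If e = uv is an edge belonging to both E(H_a) and E(H_b), then u and v are both branch vertices of H_a, or u and v are both branch vertices of H_b (or both alternatives hold). -/

import Mathlib

open SimpleGraph

/-- The complete graph on five vertices. -/
def K5 : SimpleGraph (Fin 5) := ⊤

/-- The complete bipartite graph `K_{3,3}`. -/
def K33 : SimpleGraph (Fin 6) :=
  SimpleGraph.fromRel (fun i j => i.val < 3 ∧ 3 ≤ j.val)

/-- `K_{3,3}` plus one extra edge joining two vertices in the same part. -/
def K33e : SimpleGraph (Fin 6) :=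
  SimpleGraph.fromRel (fun i j => (i.val < 3 ∧ 3 ≤ j.val) ∨ (i.val = 0 ∧ j.val = 1))

/-- `H` is a minor of `G`, witnessed by a family of nonempty, connected,
pairwise disjoint branch sets together with edges between the branch sets of
adjacent vertices of `H`. -/
def SimpleGraph.IsMinorOf {W V : Type} (H : SimpleGraph W) (G : SimpleGraph V) : Prop :=
  ∃ f : W → Set V,
    (∀ w, (G.induce (f w)).Connected) ∧
    (Pairwise fun w w' => Disjoint (f w) (f w')) ∧
    (∀ ⦃w w'⦄, H.Adj w w' → ∃ u ∈ f w, ∃ v ∈ f w', G.Adj u v)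

/-- Planarity, via the Kuratowski–Wagner characterization: a (finite simple) graph is
planar iff it has no `K₅` minor and no `K_{3,3}` minor. -/
def IsPlanar {V : Type} (G : SimpleGraph V) : Prop :=
  ¬ K5.IsMinorOf G ∧ ¬ K33.IsMinorOf G

/-- A graph is apex if it is planar or some vertex deletion makes it planar. -/
def IsApex {V : Type} (G : SimpleGraph V) : Prop :=
  IsPlanar G ∨ ∃ v : V, IsPlanar (G.induce {u | u ≠ v})

/-- `G` is an obstruction for the apex family: it is not apex, but every minor of it
that is not isomorphic to it is apex. -/
def IsApexObstruction {V : Type} (G : SimpleGraph V) : Prop :=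
  ¬ IsApex G ∧
    ∀ (W : Type) (H : SimpleGraph W), H.IsMinorOf G → IsEmpty (H ≃g G) → IsApex H

/-- Subdivide the edge `uv` of `G`: the new vertex is `none`. -/
def subdivideEdge {V : Type} (G : SimpleGraph V) (u v : V) : SimpleGraph (Option V) :=
  SimpleGraph.fromRel (fun x y =>
    (∃ a b, x = some a ∧ y = some b ∧ G.Adj a b ∧ s(a, b) ≠ s(u, v)) ∨
    (x = none ∧ (y = some u ∨ y = some v)))

/-- `IsSubdivision G H` : `H` is (isomorphic to) a graph obtained from `G` by repeatedly
subdividing edges. -/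
inductive IsSubdivision : {V : Type} → SimpleGraph V → {W : Type} → SimpleGraph W → Prop
  | of_iso {V W : Type} {G : SimpleGraph V} {H : SimpleGraph W} :
      (G ≃g H) → IsSubdivision G H
  | step {V W U : Type} {G : SimpleGraph V} {H : SimpleGraph W} {u v : W}
      {H' : SimpleGraph U} :
      H.Adj u v → IsSubdivision G H → (subdivideEdge H u v ≃g H') → IsSubdivision G H'

/-- A Kuratowski subgraph of `G` is a subgraph that is a subdivision of `K₅` or `K_{3,3}`. -/
def IsKuratowski {V : Type} {G : SimpleGraph V} (H : G.Subgraph) : Prop :=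
  IsSubdivision K5 H.coe ∨ IsSubdivision K33 H.coe

/-- A Kuratowski witness for `v` is a Kuratowski subgraph of `G` avoiding `v`. -/
def IsKuratowskiWitness {V : Type} (G : SimpleGraph V) (v : V) (H : G.Subgraph) : Prop :=
  IsKuratowski H ∧ v ∉ H.verts

/-- A branch vertex of a (Kuratowski) subgraph: a vertex of degree at least 3 in it. -/
def IsBranchVertex {V : Type} {G : SimpleGraph V} (H : G.Subgraph) (x : V) : Prop :=
  x ∈ H.verts ∧ 3 ≤ (H.neighborSet x).ncard

/-- The vertex connectivity of a finite graph: the largest `k` such that deleting any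
fewer than `k` vertices leaves a connected graph. -/
noncomputable def vConn {V : Type} [Fintype V] (G : SimpleGraph V) : ℕ :=
  sSup {k : ℕ | ∀ s : Finset V, s.card < k → (G.induce ((↑s : Set V)ᶜ)).Connected}

/-- A 2-cut: a set of two vertices whose deletion disconnects the graph. -/
def IsTwoCut {V : Type} (G : SimpleGraph V) (S : Set V) : Prop :=
  S.ncard = 2 ∧ ¬ (G.induce Sᶜ).Preconnected

/-- `C` is (the vertex set of) a connected component of `G − S`. -/
def IsCompOf {V : Type} (G : SimpleGraph V) (S : Set V) (C : Set V) : Prop :=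
  C.Nonempty ∧ Disjoint C S ∧ (G.induce C).Connected ∧
    ∀ u ∈ C, ∀ v, v ∉ S → G.Adj u v → v ∈ C

/-- The augmented component `C⁺`: the subgraph induced by `C ∪ S` together with all
edges joining vertices of `S`. -/
def augment {V : Type} (G : SimpleGraph V) (S C : Set V) : SimpleGraph ↥(C ∪ S) :=
  SimpleGraph.fromRel (fun u v => G.Adj (u : V) (v : V) ∨ ((u : V) ∈ S ∧ (v : V) ∈ S))

/-- `C` is a heavy component for the 2-cut `{a,b}`: a component of `G − {a,b}` whose
augmentation contains Kuratowski witnesses for both `a` and `b`. -/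
def IsHeavyComp {V : Type} (G : SimpleGraph V) (a b : V) (C : Set V) : Prop :=
  IsCompOf G {a, b} C ∧
    (∃ Ha : G.Subgraph, IsKuratowskiWitness G a Ha ∧ Ha.verts ⊆ C ∪ {a, b}) ∧
    (∃ Hb : G.Subgraph, IsKuratowskiWitness G b Hb ∧ Hb.verts ⊆ C ∪ {a, b})

/-- `{a,b}` is a basic 2-cut with heavy component `C`: a 2-cut whose heavy-component
weight is minimum among all 2-cuts. -/
def IsBasic2Cut {V : Type} (G : SimpleGraph V) (a b : V) (C : Set V) : Prop :=
  IsTwoCut G {a, b} ∧ IsHeavyComp G a b C ∧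
    ∀ c d : V, ∀ D : Set V, IsTwoCut G {c, d} → IsHeavyComp G c d D → C.ncard ≤ D.ncard

/-- The subgraph of `G` induced by `A`, kept on the same vertex set (vertices outside `A`
become isolated). -/
def restrictTo {V : Type} (G : SimpleGraph V) (A : Set V) : SimpleGraph V :=
  SimpleGraph.fromRel (fun u v => G.Adj u v ∧ u ∈ A ∧ v ∈ A)

/-- Contract the edge `uv` of `G`, keeping the label `u` for the merged vertex
(`v` becomes isolated). -/
def contractEdge {V : Type} (G : SimpleGraph V) (u v : V) : SimpleGraph V :=
  SimpleGraph.fromRel (fun x y =>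
    x ≠ v ∧ y ≠ v ∧ (G.Adj x y ∨ (x = u ∧ G.Adj v y) ∨ (y = u ∧ G.Adj x v)))

/-- `T` separates `a` from `b` in `G`: `a, b ∉ T` and every walk from `a` to `b`
meets `T`. -/
def Separates {V : Type} (G : SimpleGraph V) (T : Set V) (a b : V) : Prop :=
  a ∉ T ∧ b ∉ T ∧ ∀ p : G.Walk a b, ∃ t ∈ T, t ∈ p.support

/-- Disjoint union of two graphs. -/
def disjUnion {V W : Type} (G : SimpleGraph V) (H : SimpleGraph W) : SimpleGraph (V ⊕ W) :=
  SimpleGraph.fromRel (fun x y =>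
    (∃ a b, x = Sum.inl a ∧ y = Sum.inl b ∧ G.Adj a b) ∨
    (∃ a b, x = Sum.inr a ∧ y = Sum.inr b ∧ H.Adj a b))

/-- The graph on `Fin n` with the given list of edges. -/
def graphOfList (n : ℕ) (l : List (ℕ × ℕ)) : SimpleGraph (Fin n) :=
  SimpleGraph.fromRel (fun i j => ((i : ℕ), (j : ℕ)) ∈ l)

/-- A graph is 2-connected: at least three vertices and no cut vertex. -/
def IsTwoConnectedGraph {U : Type} (H : SimpleGraph U) : Prop :=
  3 ≤ Nat.card U ∧ ∀ u : U, (H.induce {x | x ≠ u}).Connected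


namespace SimpleGraph

/-- `S` is nonempty and connected in `G`: a property that is preserved along edges inside `S`
and holds somewhere on `S` holds on all of `S`. -/
def ConnOn {V : Type} (G : SimpleGraph V) (S : Set V) : Prop :=
  S.Nonempty ∧ ∀ P : V → Prop, ∀ x ∈ S, P x →
    (∀ p ∈ S, ∀ q ∈ S, G.Adj p q → P p → P q) → ∀ y ∈ S, P y

theorem Preconnected.induce_closed {V : Type} {G : SimpleGraph V} {S : Set V}
    (h : (G.induce S).Preconnected) (P : V → Prop) {x : V} (hx : x ∈ S) (hP : P x)
    (hc : ∀ p ∈ S, ∀ q ∈ S, G.Adj p q → P p → P q) {y : V} (hy : y ∈ S) : P y := by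
  obtain ⟨w⟩ := h ⟨x, hx⟩ ⟨y, hy⟩
  have key : ∀ (s t : S) (w : (G.induce S).Walk s t), P s → P t := by
    intro s t w
    induction w with
    | nil => exact id
    | cons hadj _ ih => exact fun hs => ih (hc _ (Subtype.prop _) _ (Subtype.prop _) hadj hs)
  exact key _ _ w hP

theorem connected_induce_iff_connOn {V : Type} {G : SimpleGraph V} {S : Set V} :
    (G.induce S).Connected ↔ ConnOn G S := by
  constructor
  · intro h
    obtain ⟨⟨x, hx⟩⟩ := h.nonempty
    exact ⟨⟨x, hx⟩, fun P x hx hP hc y hy => h.preconnected.induce_closed P hx hP hc hy⟩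
  · rintro ⟨⟨x, hx⟩, h⟩
    have : Nonempty S := ⟨⟨x, hx⟩⟩
    refine ⟨?_⟩
    rintro ⟨s, hs⟩ ⟨t, ht⟩
    obtain ⟨_, ht'⟩ := h (fun y => ∃ hy : y ∈ S, (G.induce S).Reachable ⟨s, hs⟩ ⟨y, hy⟩) s hs
      ⟨hs, Reachable.refl _⟩ (by
        rintro p hp q hq hpq ⟨_, hr⟩
        have hpq' : (G.induce S).Adj ⟨p, hp⟩ ⟨q, hq⟩ := hpq
        exact ⟨hq, hr.trans hpq'.reachable⟩) t ht
    exact ht'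

theorem connOn_singleton {V : Type} (G : SimpleGraph V) (x : V) : ConnOn G {x} := by
  refine ⟨⟨x, rfl⟩, ?_⟩
  rintro P _ rfl hP _ _ rfl
  exact hP

theorem ConnOn.image {V V' : Type} {G : SimpleGraph V} {G' : SimpleGraph V'} {S : Set V}
    (h : ConnOn G S) (φ : V → V')
    (hφ : ∀ p ∈ S, ∀ q ∈ S, G.Adj p q → φ p = φ q ∨ G'.Adj (φ p) (φ q)) :
    ConnOn G' (φ '' S) := by
  refine ⟨h.1.image φ, ?_⟩
  rintro P _ ⟨x, hx, rfl⟩ hP hc _ ⟨y, hy, rfl⟩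
  refine h.2 (fun z => P (φ z)) x hx hP (fun p hp q hq hpq hPp => ?_) y hy
  rcases hφ p hp q hq hpq with h' | h'
  · exact h' ▸ hPp
  · exact hc _ ⟨p, hp, rfl⟩ _ ⟨q, hq, rfl⟩ h' hPp

theorem ConnOn.congr {V : Type} {G G' : SimpleGraph V} {S : Set V}
    (h : ConnOn G S) (hφ : ∀ p ∈ S, ∀ q ∈ S, G.Adj p q → G'.Adj p q) : ConnOn G' S := by
  simpa using h.image (G' := G') id (fun p hp q hq hpq => Or.inr (hφ p hp q hq hpq))

theorem ConnOn.insert {V : Type} {G : SimpleGraph V} {S : Set V} {x s : V}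
    (h : ConnOn G S) (hs : s ∈ S) (hx : G.Adj x s) : ConnOn G (insert x S) := by
  refine ⟨⟨x, .inl rfl⟩, fun P p hp hP hc y hy => ?_⟩
  have hPs : P s := by
    rcases hp with rfl | hp
    · exact hc _ (.inl rfl) _ (.inr hs) hx hP
    · exact h.2 P p hp hP (fun p hp q hq => hc p (.inr hp) q (.inr hq)) s hs
  rcases hy with rfl | hy
  · exact hc _ (.inr hs) _ (.inl rfl) hx.symm hPs
  · exact h.2 P s hs hPs (fun p hp q hq => hc p (.inr hp) q (.inr hq)) y hy

theorem exists_component {V : Type} (G : SimpleGraph V) (S : Set V) {x : V} (hx : x ∈ S) :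
    ∃ D ⊆ S, x ∈ D ∧ ConnOn G D ∧ ∀ p ∈ D, ∀ q ∈ S, G.Adj p q → q ∈ D := by
  let D : Set V := {y | y ∈ S ∧ ∀ P : V → Prop, P x →
    (∀ p ∈ S, ∀ q ∈ S, G.Adj p q → P p → P q) → P y}
  have hcl : ∀ p ∈ D, ∀ q ∈ S, G.Adj p q → q ∈ D :=
    fun p hp q hq hpq => ⟨hq, fun P hPx hc => hc p hp.1 q hq hpq (hp.2 P hPx hc)⟩
  have hxD : x ∈ D := ⟨hx, fun _ h _ => h⟩
  refine ⟨D, fun y hy => hy.1, hxD, ⟨⟨x, hxD⟩, ?_⟩, hcl⟩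
  intro P p hp hPp hc y hy
  have hPx : P x := by
    by_contra hn
    exact (hp.2 (fun z => z ∈ D ∧ ¬ P z) ⟨hxD, hn⟩ (fun r hr q hq hrq ⟨hrD, hPr⟩ =>
      ⟨hcl r hrD q hq hrq,
        fun hPq => hPr (hc q (hcl r hrD q hq hrq) r hrD hrq.symm hPq)⟩)).2 hPp
  exact (hy.2 (fun z => z ∈ D ∧ P z) ⟨hxD, hPx⟩ (fun r hr q hq hrq ⟨hrD, hPr⟩ =>
    ⟨hcl r hrD q hq hrq, hc r hrD q (hcl r hrD q hq hrq) hrq hPr⟩)).2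

/-- `f` is a family of branch sets inside `S` showing that `T` is a minor of `G`. -/
structure ModelIn {W V : Type} (T : SimpleGraph W) (G : SimpleGraph V) (S : Set V)
    (f : W → Set V) : Prop where
  subset : ∀ w, f w ⊆ S
  conn : ∀ w, ConnOn G (f w)
  disj : ∀ ⦃w w'⦄, w ≠ w' → ∀ x ∈ f w, x ∉ f w'
  adj : ∀ ⦃w w'⦄, T.Adj w w' → ∃ u ∈ f w, ∃ v ∈ f w', G.Adj u v

/-- `G` has a `K₅` or `K_{3,3}` minor inside `S`. -/
def NonplanarOn {V : Type} (G : SimpleGraph V) (S : Set V) : Prop :=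
  (∃ f, ModelIn K5 G S f) ∨ (∃ f, ModelIn K33 G S f)

theorem isMinorOf_iff {W V : Type} {T : SimpleGraph W} {G : SimpleGraph V} :
    T.IsMinorOf G ↔ ∃ f, ModelIn T G Set.univ f := by
  constructor
  · rintro ⟨f, h1, h2, h3⟩
    exact ⟨f, fun _ => Set.subset_univ _, fun w => connected_induce_iff_connOn.1 (h1 w),
      fun w w' hw x hx hx' => Set.disjoint_left.1 (h2 hw) hx hx', h3⟩
  · rintro ⟨f, h⟩
    exact ⟨f, fun w => connected_induce_iff_connOn.2 (h.conn w),
      fun w w' hw => Set.disjoint_left.2 fun x hx hx' => h.disj hw x hx hx', h.adj⟩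

theorem isPlanar_iff {V : Type} {G : SimpleGraph V} : IsPlanar G ↔ ¬ NonplanarOn G Set.univ := by
  rw [IsPlanar, NonplanarOn, isMinorOf_iff, isMinorOf_iff, not_or]

theorem ModelIn.trans {W V' V : Type} {T : SimpleGraph W} {H : SimpleGraph V'}
    {G : SimpleGraph V} {S' : Set V'} {S : Set V} {f : W → Set V'} (h : ModelIn T H S' f)
    (g : V' → Set V) (hsub : ∀ x ∈ S', g x ⊆ S) (hconn : ∀ x ∈ S', ConnOn G (g x))
    (hdisj : ∀ x ∈ S', ∀ y ∈ S', x ≠ y → ∀ z ∈ g x, z ∉ g y)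
    (hadj : ∀ x ∈ S', ∀ y ∈ S', H.Adj x y → ∃ p ∈ g x, ∃ q ∈ g y, G.Adj p q) :
    ModelIn T G S (fun w => ⋃ x ∈ f w, g x) := by
  refine ⟨fun w => Set.iUnion₂_subset fun x hx => hsub x (h.subset w hx), fun w => ⟨?_, ?_⟩,
    ?_, ?_⟩
  · obtain ⟨x, hx⟩ := (h.conn w).1
    obtain ⟨y, hy⟩ := (hconn x (h.subset w hx)).1
    exact ⟨y, Set.mem_biUnion hx hy⟩
  · intro P x hx hP hc y hy
    simp only [Set.mem_iUnion, exists_prop] at hx hy hc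
    obtain ⟨i, hi, hxi⟩ := hx
    obtain ⟨j, hj, hyj⟩ := hy
    have spread : ∀ i ∈ f w, ∀ x ∈ g i, P x → ∀ y ∈ g i, P y := fun i hi x hx hP =>
      (hconn i (h.subset w hi)).2 P x hx hP
        (fun p hp q hq => hc p ⟨i, hi, hp⟩ q ⟨i, hi, hq⟩)
    refine (h.conn w).2 (fun i => ∀ y ∈ g i, P y) i hi (spread i hi x hxi hP) ?_ j hj y hyj
    intro p hp q hq hpq hPp
    obtain ⟨s, hs, t, ht, hst⟩ := hadj p (h.subset w hp) q (h.subset w hq) hpq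
    exact spread q hq t ht (hc s ⟨p, hp, hs⟩ t ⟨q, hq, ht⟩ hst (hPp s hs))
  · intro w w' hw x hx hx'
    simp only [Set.mem_iUnion, exists_prop] at hx hx'
    obtain ⟨i, hi, hxi⟩ := hx
    obtain ⟨j, hj, hxj⟩ := hx'
    exact hdisj i (h.subset _ hi) j (h.subset _ hj)
      (fun hij => h.disj hw i hi (hij ▸ hj)) x hxi hxj
  · intro w w' hw
    obtain ⟨i, hi, j, hj, hij⟩ := h.adj hw
    obtain ⟨p, hp, q, hq, hpq⟩ := hadj i (h.subset _ hi) j (h.subset _ hj) hij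
    exact ⟨p, Set.mem_biUnion hi hp, q, Set.mem_biUnion hj hq, hpq⟩

theorem NonplanarOn.trans {V' V : Type} {H : SimpleGraph V'}
    {G : SimpleGraph V} {S' : Set V'} {S : Set V} (h : NonplanarOn H S')
    (g : V' → Set V) (hsub : ∀ x ∈ S', g x ⊆ S) (hconn : ∀ x ∈ S', ConnOn G (g x))
    (hdisj : ∀ x ∈ S', ∀ y ∈ S', x ≠ y → ∀ z ∈ g x, z ∉ g y)
    (hadj : ∀ x ∈ S', ∀ y ∈ S', H.Adj x y → ∃ p ∈ g x, ∃ q ∈ g y, G.Adj p q) :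
    NonplanarOn G S :=
  h.imp (fun ⟨_, hf⟩ => ⟨_, hf.trans g hsub hconn hdisj hadj⟩)
    (fun ⟨_, hf⟩ => ⟨_, hf.trans g hsub hconn hdisj hadj⟩)

theorem NonplanarOn.mono {V : Type} {H G : SimpleGraph V} {S' S : Set V}
    (h : NonplanarOn H S') (hS : S' ⊆ S)
    (hadj : ∀ x ∈ S', ∀ y ∈ S', H.Adj x y → G.Adj x y) : NonplanarOn G S :=
  h.trans (fun x => {x}) (fun _ hx _ hy => hS (hy ▸ hx)) (fun x _ => connOn_singleton G x)
    (fun _ _ _ _ hxy _ hz hz' => hxy (hz.symm.trans hz'))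
    (fun x hx y hy hxy => ⟨x, rfl, y, rfl, hadj x hx y hy hxy⟩)

theorem NonplanarOn.of_induce {V : Type} {G : SimpleGraph V} {S : Set V} {A : Set S}
    {B : Set V} (h : NonplanarOn (G.induce S) A) (hB : ∀ x ∈ A, (x : V) ∈ B) :
    NonplanarOn G B :=
  h.trans (fun x => {(x : V)}) (fun _ hx _ hy => hy ▸ hB _ hx)
    (fun x _ => connOn_singleton G x)
    (fun _ _ _ _ hxy _ hz hz' => hxy (Subtype.ext (hz.symm.trans hz')))
    (fun x _ y _ hxy => ⟨x, rfl, y, rfl, hxy⟩)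

theorem NonplanarOn.to_induce {V : Type} {G : SimpleGraph V} {S : Set V} {A : Set S}
    {B : Set V} (h : NonplanarOn G B) (hB : ∀ x ∈ B, ∃ hx : x ∈ S, ⟨x, hx⟩ ∈ A) :
    NonplanarOn (G.induce S) A := by
  refine h.trans (fun x => {y | (y : V) = x}) ?_ ?_ ?_ ?_
  · rintro x hx ⟨y, hy⟩ rfl
    exact (hB _ hx).2
  · intro x hx
    obtain ⟨hxS, -⟩ := hB x hx
    convert connOn_singleton (G.induce S) ⟨x, hxS⟩ using 1
    ext y
    exact (Subtype.ext_iff (a1 := y) (a2 := ⟨x, hxS⟩)).symm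
  · rintro x _ y _ hxy z rfl hz
    exact hxy hz
  · intro x hx y hy hxy
    exact ⟨⟨x, (hB x hx).1⟩, rfl, ⟨y, (hB y hy).1⟩, rfl, hxy⟩

theorem isPlanar_induce_iff {V : Type} {G : SimpleGraph V} {S : Set V} :
    IsPlanar (G.induce S) ↔ ¬ NonplanarOn G S := by
  rw [isPlanar_iff, not_iff_not]
  exact ⟨fun h => h.of_induce fun x _ => x.2, fun h => h.to_induce fun x hx => ⟨hx, trivial⟩⟩

theorem nonplanarOn_compl_of_not_isApex {V : Type} {G : SimpleGraph V} (h : ¬ IsApex G)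
    (w : V) : NonplanarOn G {w}ᶜ := by
  by_contra hn
  exact h (Or.inr ⟨w, isPlanar_induce_iff.2 hn⟩)

theorem IsApex.exists_not_nonplanarOn {V : Type} [Nonempty V] {H : SimpleGraph V} {S : Set V}
    (h : IsApex (H.induce S)) : ∃ w, ¬ NonplanarOn H (S \ {w}) := by
  rcases h with h | ⟨v, h⟩
  · rw [isPlanar_induce_iff] at h
    exact ⟨Classical.arbitrary V, fun hn => h (hn.mono Set.sdiff_subset fun _ _ _ _ => id)⟩
  · rw [isPlanar_induce_iff] at h
    exact ⟨v, fun hn => h (hn.to_induce fun x hx => ⟨hx.1, fun hxv => hx.2 (by simp [← hxv])⟩)⟩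

theorem IsApexObstruction.exists_apex_of_ssubset {V : Type} [Fintype V] [Nonempty V]
    {G H : SimpleGraph V} (hobs : IsApexObstruction G) {S : Set V} (hS : S ≠ Set.univ)
    (f : V → Set V) (hconn : ∀ x ∈ S, ConnOn G (f x))
    (hdisj : ∀ x ∈ S, ∀ y ∈ S, x ≠ y → ∀ z ∈ f x, z ∉ f y)
    (hadj : ∀ x ∈ S, ∀ y ∈ S, H.Adj x y → ∃ p ∈ f x, ∃ q ∈ f y, G.Adj p q) :
    ∃ w, ¬ NonplanarOn H (S \ {w}) := by
  refine IsApex.exists_not_nonplanarOn (hobs.2 S (H.induce S) ?_ ⟨fun e => hS ?_⟩)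
  · exact isMinorOf_iff.2 ⟨fun x => f x, fun _ => Set.subset_univ _, fun x => hconn x x.2,
      fun s t hst => hdisj s s.2 t t.2 (fun h => hst (Subtype.ext h)),
      fun s t hst => hadj s s.2 t t.2 hst⟩
  · have hc : S.ncard = Nat.card V := Nat.card_congr e.toEquiv
    exact (Set.eq_univ_iff_ncard S).2 hc

theorem IsApexObstruction.exists_apex_deleteEdge {V : Type} [Fintype V] [Nonempty V]
    {G : SimpleGraph V} (hobs : IsApexObstruction G) {u v : V} (huv : G.Adj u v) :
    ∃ w, ¬ NonplanarOn (G.deleteEdges {s(u, v)}) {w}ᶜ := by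
  classical
  have hap : IsApex (G.deleteEdges {s(u, v)}) := by
    refine hobs.2 V _ ?_ ⟨fun e => ?_⟩
    · exact isMinorOf_iff.2 ⟨fun x => {x}, fun _ => Set.subset_univ _,
        fun x => connOn_singleton G x, fun x y hxy z hz hz' => hxy (hz.symm.trans hz'),
        fun x y hxy => ⟨x, rfl, y, rfl, (deleteEdges_adj.1 hxy).1⟩⟩
    · have h1 : G.deleteEdges {s(u, v)} < G := by
        refine lt_of_le_of_ne (deleteEdges_le _) fun h => ?_
        have := huv
        rw [← h, deleteEdges_adj] at this
        exact this.2 rfl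
      have h2 := Finset.card_lt_card (edgeFinset_ssubset_edgeFinset.2 h1)
      have h3 := e.card_edgeFinset_eq
      omega
  rcases hap with h | ⟨w, h⟩
  · rw [isPlanar_iff] at h
    exact ⟨u, fun hn => h (hn.mono (Set.subset_univ _) fun _ _ _ _ => id)⟩
  · exact ⟨w, isPlanar_induce_iff.1 h⟩

/-- `x` has three distinct neighbours. -/
def HasThreeNbrs {V : Type} (G : SimpleGraph V) (x : V) : Prop :=
  ∃ p q r, p ≠ q ∧ p ≠ r ∧ q ≠ r ∧ G.Adj x p ∧ G.Adj x q ∧ G.Adj x r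

/-- The properties shared by all subdivisions `K` of a template `T` with minimum degree three
in which deleting two vertices leaves a connected graph. -/
structure SubdivisionProps {W V : Type} (T : SimpleGraph W) (K : SimpleGraph V) : Prop where
  model : ∃ f, ModelIn T K Set.univ f
  conn_one : ∀ x, ConnOn K {x}ᶜ
  conn_two : ∀ x y, K.Adj x y → ConnOn K {x, y}ᶜ
  four : ∀ x y w : V, ∃ z, z ≠ x ∧ z ≠ y ∧ z ≠ w
  edge : ∀ x y, K.Adj x y → (HasThreeNbrs K x ∧ HasThreeNbrs K y) ∨
    ∃ f, ModelIn T K Set.univ f ∧ ∀ s t, x ∈ f s → y ∈ f t → s = t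

/-- `K'` arises from `K`, embedded by `i`, by subdividing the edge `uv` with the vertex `z`. -/
structure SubdividesAt {W U : Type} (K : SimpleGraph W) (K' : SimpleGraph U) (i : W → U)
    (z : U) (u v : W) : Prop where
  inj : Function.Injective i
  ne : ∀ w, i w ≠ z
  cover : ∀ y, y = z ∨ ∃ w, y = i w
  adj_iff : ∀ p q, K'.Adj (i p) (i q) ↔ K.Adj p q ∧ s(p, q) ≠ s(u, v)
  adj_new : ∀ p, K'.Adj z (i p) ↔ p = u ∨ p = v
  edge : K.Adj u v

namespace SubdividesAt

variable {W U : Type} {K : SimpleGraph W} {K' : SimpleGraph U} {i : W → U} {z : U} {u v : W}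

theorem symm (h : SubdividesAt K K' i z u v) : SubdividesAt K K' i z v u where
  inj := h.inj
  ne := h.ne
  cover := h.cover
  adj_iff p q := by rw [h.adj_iff, Sym2.eq_swap (a := u)]
  adj_new p := by rw [h.adj_new, or_comm]
  edge := h.edge.symm

theorem connOn_image (h : SubdividesAt K K' i z u v) {A : Set W} (hA : ConnOn K A)
    (hu : u ∉ A) : ConnOn K' (i '' A) := by
  refine hA.image i fun p hp q hq hpq => Or.inr ((h.adj_iff p q).2 ⟨hpq, fun he => hu ?_⟩)
  rcases Sym2.eq_iff.1 he with ⟨rfl, -⟩ | ⟨-, rfl⟩ <;> assumption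

theorem connOn_extend (h : SubdividesAt K K' i z u v) {A : Set W} (hA : ConnOn K A) :
    ConnOn K' (i '' A ∪ {y | y = z ∧ u ∈ A}) := by
  refine ⟨(hA.1.image i).inl, fun P x hx hP hc y hy => ?_⟩
  have hzu : u ∈ A → (P z ↔ P (i u)) := fun hu =>
    have hz : z ∈ i '' A ∪ {y | y = z ∧ u ∈ A} := .inr ⟨rfl, hu⟩
    have hiu : i u ∈ i '' A ∪ {y | y = z ∧ u ∈ A} := .inl ⟨u, hu, rfl⟩
    have hadj := (h.adj_new u).2 (.inl rfl)
    ⟨hc _ hz _ hiu hadj, hc _ hiu _ hz hadj.symm⟩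
  have hzv : u ∈ A → v ∈ A → (P z ↔ P (i v)) := fun hu hv =>
    have hz : z ∈ i '' A ∪ {y | y = z ∧ u ∈ A} := .inr ⟨rfl, hu⟩
    have hiv : i v ∈ i '' A ∪ {y | y = z ∧ u ∈ A} := .inl ⟨v, hv, rfl⟩
    have hadj := (h.adj_new v).2 (.inr rfl)
    ⟨hc _ hz _ hiv hadj, hc _ hiv _ hz hadj.symm⟩
  have hstart : ∃ p ∈ A, P (i p) := by
    rcases hx with ⟨p, hp, rfl⟩ | ⟨rfl, hu⟩
    · exact ⟨p, hp, hP⟩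
    · exact ⟨u, hu, (hzu hu).1 hP⟩
  obtain ⟨p, hp, hPp⟩ := hstart
  have hall : ∀ q ∈ A, P (i q) := by
    refine hA.2 (fun q => P (i q)) p hp hPp fun r hr s hs hrs hPr => ?_
    by_cases he : s(r, s) = s(u, v)
    · rcases Sym2.eq_iff.1 he with ⟨rfl, rfl⟩ | ⟨rfl, rfl⟩
      · exact (hzv hr hs).1 ((hzu hr).2 hPr)
      · exact (hzu hs).1 ((hzv hs hr).2 hPr)
    · exact hc _ (.inl ⟨r, hr, rfl⟩) _ (.inl ⟨s, hs, rfl⟩) ((h.adj_iff r s).2 ⟨hrs, he⟩) hPr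
  rcases hy with ⟨q, hq, rfl⟩ | ⟨rfl, hu⟩
  · exact hall q hq
  · exact (hzu hu).2 (hall u hu)

theorem modelIn_extend {W₀ : Type} {T : SimpleGraph W₀} (h : SubdividesAt K K' i z u v)
    {f : W₀ → Set W} (hf : ModelIn T K Set.univ f) :
    ModelIn T K' Set.univ (fun w => i '' f w ∪ {y | y = z ∧ u ∈ f w}) := by
  refine ⟨fun _ => Set.subset_univ _, fun w => h.connOn_extend (hf.conn w), ?_, ?_⟩
  · rintro w w' hw x (⟨p, hp, rfl⟩ | ⟨rfl, hu⟩) (⟨q, hq, he⟩ | ⟨hz, hu'⟩)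
    · exact hf.disj hw p hp (h.inj he ▸ hq)
    · exact h.ne _ hz
    · exact h.ne _ he
    · exact hf.disj hw u hu hu'
  · intro w w' hw
    obtain ⟨p, hp, q, hq, hpq⟩ := hf.adj hw
    by_cases he : s(p, q) = s(u, v)
    · rcases Sym2.eq_iff.1 he with ⟨rfl, rfl⟩ | ⟨rfl, rfl⟩
      · exact ⟨z, .inr ⟨rfl, hp⟩, i q, .inl ⟨q, hq, rfl⟩, (h.adj_new q).2 (.inr rfl)⟩
      · exact ⟨i p, .inl ⟨p, hp, rfl⟩, z, .inr ⟨rfl, hq⟩, ((h.adj_new p).2 (.inr rfl)).symm⟩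
    · exact ⟨i p, .inl ⟨p, hp, rfl⟩, i q, .inl ⟨q, hq, rfl⟩, (h.adj_iff p q).2 ⟨hpq, he⟩⟩

theorem mem_extend (h : SubdividesAt K K' i z u v) {A : Set W} {p : W} :
    i p ∈ i '' A ∪ {y | y = z ∧ u ∈ A} ↔ p ∈ A := by
  constructor
  · rintro (⟨q, hq, he⟩ | ⟨hz, -⟩)
    · exact h.inj he ▸ hq
    · exact absurd hz (h.ne p)
  · exact fun hp => .inl ⟨p, hp, rfl⟩

theorem new_mem_extend (h : SubdividesAt K K' i z u v) {A : Set W} :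
    z ∈ i '' A ∪ {y | y = z ∧ u ∈ A} ↔ u ∈ A := by
  constructor
  · rintro (⟨q, -, he⟩ | ⟨-, hu⟩)
    · exact absurd he (h.ne q)
    · exact hu
  · exact fun hp => .inr ⟨rfl, hp⟩

theorem exists_adj_iff (h : SubdividesAt K K' i z u v) {x : W} :
    ∃ g : W → U, (∀ p q, K.Adj x p → K.Adj x q → g p = g q → p = q) ∧
      ∀ p, K.Adj x p → K'.Adj (i x) (g p) := by
  classical
  refine ⟨fun p => if s(x, p) = s(u, v) then z else i p, fun p q hp hq hpq => ?_, fun p hp => ?_⟩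
  · dsimp only at hpq
    split_ifs at hpq with h1 h2 h2
    · exact Sym2.congr_right.1 (h1.trans h2.symm)
    · exact absurd hpq.symm (h.ne _)
    · exact absurd hpq (h.ne _)
    · exact h.inj hpq
  · dsimp only
    split_ifs with h1
    · refine ((h.adj_new x).2 ?_).symm
      rcases Sym2.eq_iff.1 h1 with ⟨rfl, -⟩ | ⟨rfl, -⟩
      · exact .inl rfl
      · exact .inr rfl
    · exact (h.adj_iff x p).2 ⟨hp, h1⟩

theorem hasThreeNbrs (h : SubdividesAt K K' i z u v) {x : W} (hx : HasThreeNbrs K x) :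
    HasThreeNbrs K' (i x) := by
  obtain ⟨p, q, r, hpq, hpr, hqr, hp, hq, hr⟩ := hx
  obtain ⟨g, hg, hadj⟩ := h.exists_adj_iff (x := x)
  exact ⟨g p, g q, g r, fun he => hpq (hg _ _ hp hq he), fun he => hpr (hg _ _ hp hr he),
    fun he => hqr (hg _ _ hq hr he), hadj p hp, hadj q hq, hadj r hr⟩

theorem connOn_compl (h : SubdividesAt K K' i z u v) {A : Set W} {B : Set U} (hA : ConnOn K A)
    (hu : u ∈ A) (hB : ∀ p, i p ∈ B ↔ p ∈ A) (hz : z ∈ B) : ConnOn K' B := by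
  convert h.connOn_extend hA using 1
  ext y
  rcases h.cover y with rfl | ⟨w, rfl⟩
  · rw [h.new_mem_extend]; exact iff_of_true hz hu
  · rw [h.mem_extend, hB]

theorem connOn_compl_new (h : SubdividesAt K K' i z u v) {B : Set U} (hA : ConnOn K {u}ᶜ)
    (hB : ∀ p, i p ∈ B ↔ p ≠ u) (hz : z ∉ B) : ConnOn K' B := by
  convert h.connOn_image hA (by simp) using 1
  ext y
  rcases h.cover y with rfl | ⟨w, rfl⟩
  · exact iff_of_false hz (by rintro ⟨p, -, hp⟩; exact h.ne p hp)
  · rw [hB, h.inj.mem_set_image]; rfl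

theorem exists_model_new_edge {W₀ : Type} {T : SimpleGraph W₀} (h : SubdividesAt K K' i z u v)
    (hK : SubdivisionProps T K) :
    ∃ f, ModelIn T K' Set.univ f ∧ ∀ w w', z ∈ f w → i u ∈ f w' → w = w' := by
  obtain ⟨f, hf⟩ := hK.model
  refine ⟨_, h.modelIn_extend hf, fun w w' hw hw' => ?_⟩
  rw [h.new_mem_extend] at hw
  rw [h.mem_extend] at hw'
  by_contra hne
  exact hf.disj hne _ hw hw'

theorem props {W₀ : Type} {T : SimpleGraph W₀} (h : SubdividesAt K K' i z u v)
    (hK : SubdivisionProps T K) : SubdivisionProps T K' where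
  model := hK.model.elim fun _ hf => ⟨_, h.modelIn_extend hf⟩
  conn_one x := by
    rcases h.cover x with rfl | ⟨p, rfl⟩
    · obtain ⟨s, hs, hsv⟩ : ∃ s, K.Adj u s ∧ s ≠ v := by
        by_contra! hn
        obtain ⟨t, htu, htv, -⟩ := hK.four u v v
        exact htu ((hK.conn_one v).2 (fun y => y = u) u h.edge.ne rfl
          (by rintro p hp q hq hpq rfl; exact absurd (hn q hpq) hq) t htv)
      have hsu : s ≠ u := hs.ne'
      convert (h.connOn_image (hK.conn_one u) (by simp)).insert (s := i s) (x := i u)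
        ⟨s, hsu, rfl⟩ ((h.adj_iff u s).2 ⟨hs, fun he => hsv (Sym2.congr_right.1 he)⟩) using 1
      ext y
      rcases h.cover y with rfl | ⟨w, rfl⟩
      · simp [h.ne, (h.ne _).symm]
      · simp [h.ne, h.inj.eq_iff, em]
    · by_cases hp : u = p
      · subst hp
        exact h.symm.connOn_compl (hK.conn_one u) h.edge.ne' (by simp [h.inj.eq_iff])
          (by simpa using (h.ne u).symm)
      · exact h.connOn_compl (hK.conn_one p) hp (by simp [h.inj.eq_iff])
          (by simpa using (h.ne p).symm)
  conn_two x y hxy := by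
    have new : ∀ p, K'.Adj z (i p) → ConnOn K' {z, i p}ᶜ := by
      intro p hp
      rcases (h.adj_new p).1 hp with rfl | rfl
      · exact h.connOn_compl_new (hK.conn_one p) (by simp [h.inj.eq_iff, h.ne]) (by simp)
      · exact h.symm.connOn_compl_new (hK.conn_one p) (by simp [h.inj.eq_iff, h.ne]) (by simp)
    rcases h.cover x with rfl | ⟨p, rfl⟩ <;> rcases h.cover y with rfl | ⟨q, rfl⟩
    · exact absurd rfl hxy.ne
    · exact new q hxy
    · rw [Set.pair_comm]; exact new p hxy.symm
    · obtain ⟨hpq, hne⟩ := (h.adj_iff p q).1 hxy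
      have hz : z ∈ ({i p, i q} : Set U)ᶜ := by
        simpa using ⟨(h.ne p).symm, (h.ne q).symm⟩
      by_cases hu : u = p ∨ u = q
      · refine h.symm.connOn_compl (hK.conn_two p q hpq) ?_ (by simp [h.inj.eq_iff]) hz
        have := h.edge.ne
        rintro (rfl | rfl) <;> rcases hu with rfl | rfl <;> simp_all
      · exact h.connOn_compl (hK.conn_two p q hpq) (by simpa using hu)
          (by simp [h.inj.eq_iff]) hz
  four x y w := by
    have key : ∀ y, ∃ p, ∀ q, q ≠ p → i q ≠ y := by
      intro y
      rcases h.cover y with rfl | ⟨p, rfl⟩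
      · exact ⟨u, fun q _ => h.ne q⟩
      · exact ⟨p, fun q hq he => hq (h.inj he)⟩
    obtain ⟨p, hp⟩ := key x
    obtain ⟨q, hq⟩ := key y
    obtain ⟨r, hr⟩ := key w
    obtain ⟨t, h1, h2, h3⟩ := hK.four p q r
    exact ⟨i t, hp t h1, hq t h2, hr t h3⟩
  edge x y hxy := by
    have new : ∀ p, K'.Adj z (i p) →
        ∃ f, ModelIn T K' Set.univ f ∧ ∀ w w', z ∈ f w → i p ∈ f w' → w = w' := by
      intro p hp
      rcases (h.adj_new p).1 hp with rfl | rfl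
      · exact h.exists_model_new_edge hK
      · exact h.symm.exists_model_new_edge hK
    rcases h.cover x with rfl | ⟨p, rfl⟩ <;> rcases h.cover y with rfl | ⟨q, rfl⟩
    · exact absurd rfl hxy.ne
    · exact .inr (new q hxy)
    · obtain ⟨f, hf, hw⟩ := new p hxy.symm
      exact .inr ⟨f, hf, fun w w' h1 h2 => (hw w' w h2 h1).symm⟩
    · rcases hK.edge p q ((h.adj_iff p q).1 hxy).1 with ⟨hp, hq⟩ | ⟨f, hf, hw⟩
      · exact .inl ⟨h.hasThreeNbrs hp, h.hasThreeNbrs hq⟩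
      · refine .inr ⟨_, h.modelIn_extend hf, fun w w' h1 h2 => ?_⟩
        rw [h.mem_extend] at h1 h2
        exact hw w w' h1 h2

end SubdividesAt

theorem subdividesAt_of_iso {W U : Type} {H : SimpleGraph W} {H' : SimpleGraph U} {u v : W}
    (huv : H.Adj u v) (e : subdivideEdge H u v ≃g H') :
    SubdividesAt H H' (fun w => e (some w)) (e none) u v where
  inj p q hpq := Option.some.inj (e.injective hpq)
  ne w he := Option.some_ne_none w (e.injective he)
  cover y := by
    obtain ⟨t, rfl⟩ := e.surjective y
    cases t with
    | none => exact .inl rfl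
    | some w => exact .inr ⟨w, rfl⟩
  adj_iff p q := by
    rw [e.map_adj_iff]
    simp only [subdivideEdge, fromRel_adj, Option.some.injEq, reduceCtorEq, false_and, or_false,
      ne_eq]
    constructor
    · rintro ⟨-, ⟨a, b, rfl, rfl, h⟩ | ⟨a, b, rfl, rfl, h⟩⟩
      · exact h
      · exact ⟨h.1.symm, by rw [Sym2.eq_swap]; exact h.2⟩
    · exact fun h => ⟨h.1.ne, .inl ⟨p, q, rfl, rfl, h⟩⟩
  adj_new p := by
    rw [e.map_adj_iff]
    simp [subdivideEdge, fromRel_adj]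
  edge := huv

/-- The properties of `K₅` and `K_{3,3}` that are used: the minimum degree is at least three and
after deleting two vertices, any two others are equal, adjacent or have a common neighbour. -/
structure IsTemplate {W : Type} (T : SimpleGraph W) : Prop where
  three : ∀ x, HasThreeNbrs T x
  four : ∀ x y w : W, ∃ z, z ≠ x ∧ z ≠ y ∧ z ≠ w
  link : ∀ (x y : Option W) (p q : W), x ≠ some p → y ≠ some p → x ≠ some q → y ≠ some q →
    p = q ∨ T.Adj p q ∨ ∃ r, x ≠ some r ∧ y ≠ some r ∧ T.Adj p r ∧ T.Adj r q

theorem isTemplate_K5 : IsTemplate K5 where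
  three := by simp only [HasThreeNbrs, K5, top_adj]; decide
  four := by decide
  link x y p q _ _ _ _ := or_iff_not_imp_left.2 fun h => .inl h

theorem isTemplate_K33 : IsTemplate K33 where
  three := by simp only [HasThreeNbrs, K33, fromRel_adj]; decide
  four := by decide
  link := by
    have avoid : ∀ x y : Option (Fin 6), (∃ r : Fin 6, x ≠ some r ∧ y ≠ some r ∧ r.val < 3) ∧
        ∃ r : Fin 6, x ≠ some r ∧ y ≠ some r ∧ 3 ≤ r.val := by decide
    intro x y p q _ _ _ _
    obtain ⟨⟨r, hxr, hyr, hr⟩, s, hxs, hys, hs⟩ := avoid x y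
    simp only [K33, fromRel_adj]
    grind

theorem IsTemplate.connOn {W : Type} {T : SimpleGraph W} (hT : IsTemplate T) (x y : W) :
    ConnOn T {x, y}ᶜ := by
  refine ⟨?_, fun P p hp hP hc q hq => ?_⟩
  · obtain ⟨z, hz⟩ := hT.four x y y
    exact ⟨z, by simp [hz]⟩
  · simp only [Set.mem_compl_iff, Set.mem_insert_iff, Set.mem_singleton_iff, not_or] at *
    rcases hT.link (some x) (some y) p q (by grind) (by grind) (by grind) (by grind) with
      rfl | h | ⟨r, hx, hy, h1, h2⟩
    · exact hP
    · exact hc p hp q hq h hP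
    · have hr : r ≠ x ∧ r ≠ y := by grind
      exact hc r hr q hq h2 (hc p hp r hr h1 hP)

theorem IsTemplate.props_of_iso {W V : Type} {T : SimpleGraph W} (hT : IsTemplate T)
    {K : SimpleGraph V} (e : T ≃g K) : SubdivisionProps T K := by
  have conn : ∀ x y, ConnOn K {x, y}ᶜ := by
    intro x y
    convert (hT.connOn (e.symm x) (e.symm y)).image (G' := K) e
      (fun p _ q _ hpq => .inr (e.map_adj_iff.2 hpq)) using 1
    ext z
    obtain ⟨z, rfl⟩ := e.surjective z
    rw [e.injective.mem_set_image]
    simp [← e.injective.eq_iff]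
  refine ⟨⟨fun w => {e w}, fun _ => Set.subset_univ _, fun w => connOn_singleton K _, ?_, ?_⟩,
    fun x => by simpa using conn x x, fun x y _ => conn x y, ?_, ?_⟩
  · exact fun w w' hw z hz hz' => hw (e.injective (hz.symm.trans hz'))
  · exact fun w w' hw => ⟨_, rfl, _, rfl, e.map_adj_iff.2 hw⟩
  · intro x y w
    obtain ⟨z, h1, h2, h3⟩ := hT.four (e.symm x) (e.symm y) (e.symm w)
    refine ⟨e z, ?_, ?_, ?_⟩ <;> rintro rfl <;> simp_all
  · have three : ∀ x, HasThreeNbrs K x := by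
      intro x
      obtain ⟨x, rfl⟩ := e.surjective x
      obtain ⟨p, q, r, h1, h2, h3, h4, h5, h6⟩ := hT.three x
      exact ⟨e p, e q, e r, e.injective.ne h1, e.injective.ne h2, e.injective.ne h3,
        e.map_adj_iff.2 h4, e.map_adj_iff.2 h5, e.map_adj_iff.2 h6⟩
    exact fun x y _ => .inl ⟨three x, three y⟩

theorem IsTemplate.props {W V : Type} {T : SimpleGraph W} {K : SimpleGraph V}
    (hT : IsTemplate T) (h : IsSubdivision T K) : SubdivisionProps T K := by
  induction h with
  | of_iso e => exact hT.props_of_iso e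
  | step huv _ e ih => exact (subdividesAt_of_iso huv e).props (ih hT)

theorem contractEdge_adj {V : Type} {G : SimpleGraph V} {u v x y : V} :
    (contractEdge G u v).Adj x y ↔ x ≠ y ∧ x ≠ v ∧ y ≠ v ∧
      (G.Adj x y ∨ (x = u ∧ G.Adj v y) ∨ (y = u ∧ G.Adj x v)) := by
  simp only [contractEdge, fromRel_adj]
  grind [SimpleGraph.adj_comm]

/-- The map identifying `v` with `u`. -/
noncomputable def contractMap {V : Type} (u v x : V) : V :=
  open Classical in if x = v then u else x

theorem contractMap_adj {V : Type} {G : SimpleGraph V} {u v p q : V} (huv : u ≠ v)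
    (h : G.Adj p q) : contractMap u v p = contractMap u v q ∨
      (contractEdge G u v).Adj (contractMap u v p) (contractMap u v q) := by
  simp only [contractEdge_adj, contractMap]
  grind

theorem ModelIn.contract {W V : Type} {T : SimpleGraph W} {G : SimpleGraph V} {S : Set V}
    {f : W → Set V} (h : ModelIn T G S f) {u v : V} (hu : u ∈ S) (huv : u ≠ v)
    (hw : ∀ w w', u ∈ f w → v ∈ f w' → w = w') :
    ModelIn T (contractEdge G u v) (S \ {v}) (fun w => contractMap u v '' f w) := by
  have hdisj : ∀ ⦃w w'⦄, w ≠ w' → ∀ x ∈ f w, ∀ y ∈ f w', contractMap u v x ≠ contractMap u v y := by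
    intro w w' hne x hx y hy
    have h1 := h.disj hne x hx
    have h2 := hw w w'
    have h3 := hw w' w
    have h4 := h.disj hne y
    simp only [contractMap]
    grind
  refine ⟨?_, fun w => (h.conn w).image _ fun p _ q _ hpq => contractMap_adj huv hpq, ?_, ?_⟩
  · rintro w _ ⟨x, hx, rfl⟩
    have := h.subset w hx
    simp only [contractMap, Set.mem_sdiff, Set.mem_singleton_iff]
    grind
  · rintro w w' hne _ ⟨x, hx, rfl⟩ ⟨y, hy, he⟩
    exact hdisj hne x hx y hy he.symm
  · intro w w' hww
    obtain ⟨p, hp, q, hq, hpq⟩ := h.adj hww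
    exact ⟨_, ⟨p, hp, rfl⟩, _, ⟨q, hq, rfl⟩,
      (contractMap_adj huv hpq).resolve_left (hdisj hww.ne p hp q hq)⟩

/-- What is used about the vertex set `S` of a Kuratowski subgraph containing the edge `uv`
whose ends are not both branch vertices. -/
structure KuratowskiOn {V : Type} (G : SimpleGraph V) (S : Set V) (u v : V) : Prop where
  nonplanarOn : NonplanarOn G S
  left_mem : u ∈ S
  right_mem : v ∈ S
  conn_one : ∀ x, ConnOn G (S \ {x})
  conn_two : ConnOn G (S \ {u, v})
  four : ∀ x y w, ∃ z ∈ S, z ≠ x ∧ z ≠ y ∧ z ≠ w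
  contract : NonplanarOn (contractEdge G u v) (S \ {v})

section Subgraph

variable {W V : Type} {T : SimpleGraph W} {G : SimpleGraph V} {H : G.Subgraph}

theorem ModelIn.of_coe {f : W → Set H.verts} (h : ModelIn T H.coe Set.univ f) :
    ModelIn T G H.verts (fun w => Subtype.val '' f w) where
  subset w := by rintro _ ⟨x, -, rfl⟩; exact x.2
  conn w := (h.conn w).image _ fun _ _ _ _ hpq => .inr (H.adj_sub hpq)
  disj := by
    rintro w w' hw _ ⟨x, hx, rfl⟩ ⟨y, hy, he⟩
    exact h.disj hw x hx (Subtype.ext he ▸ hy)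
  adj w w' hw := by
    obtain ⟨p, hp, q, hq, hpq⟩ := h.adj hw
    exact ⟨p, ⟨p, hp, rfl⟩, q, ⟨q, hq, rfl⟩, H.adj_sub hpq⟩

theorem ConnOn.of_coe {A : Set H.verts} {B : Set V} (h : ConnOn H.coe A)
    (hB : ∀ x, x ∈ B ↔ ∃ hx : x ∈ H.verts, ⟨x, hx⟩ ∈ A) : ConnOn G B := by
  convert h.image (G' := G) Subtype.val fun _ _ _ _ hpq => .inr (H.adj_sub hpq) using 1
  ext x
  simp [hB]

theorem HasThreeNbrs.isBranchVertex [Finite V] {x : H.verts} (h : HasThreeNbrs H.coe x) :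
    IsBranchVertex H x := by
  obtain ⟨p, q, r, h1, h2, h3, h4, h5, h6⟩ := h
  refine ⟨x.2, (Set.two_lt_ncard_iff (Set.toFinite _)).2 ⟨p, q, r, h4, h5, h6, ?_, ?_, ?_⟩⟩
  · exact fun h => h1 (Subtype.ext h)
  · exact fun h => h2 (Subtype.ext h)
  · exact fun h => h3 (Subtype.ext h)

theorem SubdivisionProps.kuratowskiOn [Finite V] (h : SubdivisionProps T H.coe)
    (hT : ∀ {G : SimpleGraph V} {S : Set V} {f}, ModelIn T G S f → NonplanarOn G S) {u v : V}
    (huv : H.Adj u v) (hn : ¬ (IsBranchVertex H u ∧ IsBranchVertex H v)) :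
    KuratowskiOn G H.verts u v where
  nonplanarOn := h.model.elim fun _ hf => hT hf.of_coe
  left_mem := H.edge_vert huv
  right_mem := H.edge_vert huv.symm
  conn_one x := by
    by_cases hx : x ∈ H.verts
    · exact (h.conn_one ⟨x, hx⟩).of_coe fun y => by simp
    · obtain ⟨z, hz, -, -⟩ := h.four ⟨u, H.edge_vert huv⟩ ⟨u, H.edge_vert huv⟩
        ⟨u, H.edge_vert huv⟩
      have huniv : ConnOn H.coe (insert z {z}ᶜ) := by
        obtain ⟨t, ht⟩ : ∃ t, H.coe.Adj z t := by
          by_contra! hno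
          obtain ⟨t, ht1, ht2, -⟩ := h.four z ⟨u, H.edge_vert huv⟩ z
          exact ht1 ((h.conn_one ⟨u, H.edge_vert huv⟩).2 (fun y => y = z) z hz rfl
            (by rintro p - q - hpq rfl; exact absurd hpq (hno q)) t ht2)
        exact (h.conn_one z).insert ht.ne' ht
      refine huniv.of_coe fun y => ?_
      simp only [Set.mem_sdiff, Set.mem_singleton_iff, Set.mem_insert_iff, Set.mem_compl_iff]
      exact ⟨fun hy => ⟨hy.1, em _⟩, fun ⟨hy, _⟩ => ⟨hy, by rintro rfl; exact hx hy⟩⟩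
  conn_two := (h.conn_two ⟨u, H.edge_vert huv⟩ ⟨v, H.edge_vert huv.symm⟩ huv).of_coe
    fun y => by simp; tauto
  four x y w := by
    have key : ∀ y : V, ∃ p : H.verts, ∀ q : H.verts, q ≠ p → (q : V) ≠ y := by
      intro y
      by_cases hy : y ∈ H.verts
      · exact ⟨⟨y, hy⟩, fun q hq he => hq (Subtype.ext he)⟩
      · exact ⟨⟨u, H.edge_vert huv⟩, fun q _ he => hy (he ▸ q.2)⟩
    obtain ⟨p, hp⟩ := key x
    obtain ⟨q, hq⟩ := key y
    obtain ⟨r, hr⟩ := key w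
    obtain ⟨z, h1, h2, h3⟩ := h.four p q r
    exact ⟨z, z.2, hp z h1, hq z h2, hr z h3⟩
  contract := by
    rcases h.edge ⟨u, H.edge_vert huv⟩ ⟨v, H.edge_vert huv.symm⟩ huv with ⟨h1, h2⟩ | ⟨f, hf, hw⟩
    · exact absurd ⟨h1.isBranchVertex, h2.isBranchVertex⟩ hn
    · refine hT (hf.of_coe.contract (H.edge_vert huv) huv.ne ?_)
      rintro w w' ⟨x, hx, rfl⟩ ⟨y, hy, rfl⟩
      exact hw w w' hx hy

theorem _root_.IsKuratowski.kuratowskiOn [Finite V] (h : IsKuratowski H) {u v : V}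
    (huv : H.Adj u v) (hn : ¬ (IsBranchVertex H u ∧ IsBranchVertex H v)) :
    KuratowskiOn G H.verts u v := by
  rcases h with h | h
  · exact (isTemplate_K5.props h).kuratowskiOn (fun hf => .inl ⟨_, hf⟩) huv hn
  · exact (isTemplate_K33.props h).kuratowskiOn (fun hf => .inr ⟨_, hf⟩) huv hn

theorem _root_.IsKuratowski.nonplanarOn (h : IsKuratowski H) : NonplanarOn G H.verts := by
  rcases h with h | h
  · obtain ⟨f, hf⟩ := (isTemplate_K5.props h).model
    exact .inl ⟨_, hf.of_coe⟩
  · obtain ⟨f, hf⟩ := (isTemplate_K33.props h).model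
    exact .inr ⟨_, hf.of_coe⟩

end Subgraph

theorem sup_edge_adj {V : Type} {G : SimpleGraph V} {a b x y : V} :
    (G ⊔ edge a b).Adj x y ↔ G.Adj x y ∨ ((x = a ∧ y = b ∨ x = b ∧ y = a) ∧ x ≠ y) := by
  rw [sup_adj, edge_adj]

theorem ModelIn.restrict_side {W V : Type} {T : SimpleGraph W}
    {G : SimpleGraph V} {A B : Set V} {a b : V} {f : W → Set V}
    (h : ModelIn T G (A ∪ B ∪ {a, b}) f) (hAB : ∀ x ∈ A, ∀ y ∈ B, ¬ G.Adj x y)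
    (hside : ∀ t, a ∉ f t → b ∉ f t → f t ⊆ A) (hd : Disjoint A B)
    (hab : a ≠ b) :
    ∃ f', ModelIn T (G ⊔ edge a b) (A ∪ {a, b}) f' := by
  classical
  refine ⟨fun t => f t ∩ (A ∪ {a, b}), fun t => Set.inter_subset_right, fun t => ?_,
    fun t t' ht x hx hx' => h.disj ht x hx.1 hx'.1, fun t t' ht => ?_⟩
  · have hB : ∀ x ∈ f t, x ∉ A ∪ {a, b} → x ∈ B := by
      intro x hx hn
      have := h.subset t hx
      grind
    have hmem : (∃ x ∈ f t, x ∉ A ∪ {a, b}) → a ∈ f t ∨ b ∈ f t := by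
      rintro ⟨x, hx, hn⟩
      by_contra! hc
      exact hn (.inl (hside t hc.1 hc.2 hx))
    let ρ : V → V := fun x => if x ∈ A ∪ {a, b} then x else if a ∈ f t then a else b
    have him : ρ '' f t = f t ∩ (A ∪ {a, b}) := by
      ext y
      constructor
      · rintro ⟨x, hx, rfl⟩
        by_cases hxA : x ∈ A ∪ {a, b}
        · rw [show ρ x = x from if_pos hxA]
          exact ⟨hx, hxA⟩
        · have := hmem ⟨x, hx, hxA⟩
          by_cases ha : a ∈ f t
          · simp only [ρ, hxA, ha, if_true, if_false]; exact ⟨ha, by simp⟩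
          · simp only [ρ, hxA, ha, if_false]; exact ⟨this.resolve_left ha, by simp⟩
      · exact fun hy => ⟨y, hy.1, if_pos hy.2⟩
    change ConnOn _ (f t ∩ (A ∪ {a, b}))
    rw [← him]
    refine (h.conn t).image ρ fun p hp q hq hpq => ?_
    have hp' := hB p hp
    have hq' := hB q hq
    have h1 := hAB p
    have h2 := hAB q
    have h3 := hpq.symm
    have h4 := Set.disjoint_left.1 hd
    rw [sup_edge_adj]
    simp only [ρ, Set.mem_union, Set.mem_insert_iff, Set.mem_singleton_iff] at *
    grind
  · obtain ⟨p, hp, q, hq, hpq⟩ := h.adj ht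
    have hp' := h.subset t hp
    have hq' := h.subset t' hq
    have h1 := hAB p
    have h2 := hAB q
    have h3 := hpq.symm
    have h4 := Set.disjoint_left.1 hd
    have h5 := h.disj ht.ne a
    have h6 := h.disj ht.ne b
    have h7 := hside t
    have h8 := hside t'
    by_cases hE : (a ∈ f t ∨ b ∈ f t) ∧ (a ∈ f t' ∨ b ∈ f t')
    · rcases hE with ⟨h9 | h9, h10 | h10⟩
      · exact absurd h10 (h5 h9)
      · exact ⟨a, ⟨h9, by simp⟩, b, ⟨h10, by simp⟩, by rw [sup_edge_adj]; simp [hab]⟩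
      · exact ⟨b, ⟨h9, by simp⟩, a, ⟨h10, by simp⟩, by rw [sup_edge_adj]; simp [hab.symm]⟩
      · exact absurd h10 (h6 h9)
    · refine ⟨p, ⟨hp, ?_⟩, q, ⟨hq, ?_⟩, sup_edge_adj.2 (.inl hpq)⟩
      all_goals
        simp only [Set.mem_union, Set.mem_insert_iff, Set.mem_singleton_iff] at *
        grind

theorem ModelIn.two_sum {W V : Type} {T : SimpleGraph W} (hT : IsTemplate T)
    {G : SimpleGraph V} {A B : Set V} {a b : V} {f : W → Set V}
    (h : ModelIn T G (A ∪ B ∪ {a, b}) f) (hAB : ∀ x ∈ A, ∀ y ∈ B, ¬ G.Adj x y)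
    (hd : Disjoint A B)
    (hab : a ≠ b) :
    (∃ f', ModelIn T (G ⊔ edge a b) (A ∪ {a, b}) f') ∨
      ∃ f', ModelIn T (G ⊔ edge a b) (B ∪ {a, b}) f' := by
  have index : ∀ c, ∃ x : Option W, ∀ t, c ∈ f t ↔ x = some t := by
    intro c
    by_cases hc : ∃ t, c ∈ f t
    · obtain ⟨t, ht⟩ := hc
      refine ⟨some t, fun t' => ⟨fun ht' => ?_, fun he => Option.some.inj he ▸ ht⟩⟩
      by_contra hne
      exact h.disj (fun he => hne (congrArg some he)) c ht ht'
    · exact ⟨none, fun t => ⟨fun ht => absurd ⟨t, ht⟩ hc, fun h => nomatch h⟩⟩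
  obtain ⟨x, hx⟩ := index a
  obtain ⟨y, hy⟩ := index b
  have pure : ∀ t, a ∉ f t → b ∉ f t → f t ⊆ A ∨ f t ⊆ B := by
    intro t ha hb
    have hsub : ∀ p ∈ f t, p ∈ A ∨ p ∈ B := by
      intro p hp
      have := h.subset t hp
      grind
    obtain ⟨p, hp⟩ := (h.conn t).1
    rcases hsub p hp with hpA | hpB
    · exact .inl ((h.conn t).2 (· ∈ A) p hp hpA fun r _ s hs hrs hr =>
        (hsub s hs).resolve_right fun hsB => hAB r hr s hsB hrs)
    · exact .inr ((h.conn t).2 (· ∈ B) p hp hpB fun r _ s hs hrs hr =>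
        (hsub s hs).resolve_left fun hsA => hAB s hsA r hr hrs.symm)
  have step : ∀ t t', a ∉ f t → b ∉ f t → a ∉ f t' → b ∉ f t' → T.Adj t t' →
      f t ⊆ A → f t' ⊆ A := by
    intro t t' _ _ ha hb htt hA
    rcases pure t' ha hb with h' | h'
    · exact h'
    · obtain ⟨p, hp, q, hq, hpq⟩ := h.adj htt
      exact absurd hpq (hAB p (hA hp) q (h' hq))
  have spread : ∀ t t', a ∉ f t → b ∉ f t → a ∉ f t' → b ∉ f t' → f t ⊆ A → f t' ⊆ A := by
    intro t t' h1 h2 h3 h4 hA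
    have h1' := h1
    have h2' := h2
    have h3' := h3
    have h4' := h4
    rw [hx] at h1' h3'
    rw [hy] at h2' h4'
    rcases hT.link x y t t' h1' h2' h3' h4' with rfl | hadj | ⟨r, hr1, hr2, hr3, hr4⟩
    · exact hA
    · exact step t t' h1 h2 h3 h4 hadj hA
    · rw [ne_eq, ← hx] at hr1
      rw [ne_eq, ← hy] at hr2
      exact step r t' hr1 hr2 h3 h4 hr4 (step t r h1 h2 hr1 hr2 hr3 hA)
  by_cases hex : ∃ t, a ∉ f t ∧ b ∉ f t ∧ f t ⊆ A
  · obtain ⟨t, h1, h2, h3⟩ := hex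
    exact .inl (h.restrict_side hAB (fun t' h1' h2' => spread t t' h1 h2 h1' h2' h3) hd hab)
  · rw [Set.union_comm A B] at h
    refine .inr (h.restrict_side (fun p hp q hq hpq => hAB q hq p hp hpq.symm)
      (fun t' h1' h2' => (pure t' h1' h2').resolve_left fun h' => hex ⟨t', h1', h2', h'⟩)
      hd.symm hab)

theorem NonplanarOn.two_sum {V : Type} {G : SimpleGraph V} {A B : Set V} {a b : V}
    (h : NonplanarOn G (A ∪ B ∪ {a, b})) (hAB : ∀ x ∈ A, ∀ y ∈ B, ¬ G.Adj x y)
    (hd : Disjoint A B)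
    (hab : a ≠ b) :
    NonplanarOn (G ⊔ edge a b) (A ∪ {a, b}) ∨ NonplanarOn (G ⊔ edge a b) (B ∪ {a, b}) := by
  rcases h with ⟨f, hf⟩ | ⟨f, hf⟩
  · exact (hf.two_sum isTemplate_K5 hAB hd hab).imp .inl .inl
  · exact (hf.two_sum isTemplate_K33 hAB hd hab).imp .inr .inr

theorem NonplanarOn.detour {V : Type} {G : SimpleGraph V} {S Q : Set V} {u v p q : V}
    (h : NonplanarOn G S) (huv : u ≠ v) (hQ : ConnOn G Q) (hSQ : ∀ x ∈ Q, x ∉ S)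
    (hu : u ∉ Q) (hv : v ∉ Q) (hp : p ∈ Q) (hup : G.Adj p u) (hq : q ∈ Q) (hvq : G.Adj q v) :
    NonplanarOn (G.deleteEdges {s(u, v)}) (S ∪ Q) := by
  classical
  have hadj : ∀ x y, G.Adj x y → x ∈ Q → (G.deleteEdges {s(u, v)}).Adj x y := by
    intro x y hxy hx
    refine deleteEdges_adj.2 ⟨hxy, fun he => ?_⟩
    rcases Sym2.eq_iff.1 (Set.mem_singleton_iff.1 he) with ⟨rfl, -⟩ | ⟨rfl, -⟩
    · exact hu hx
    · exact hv hx
  refine h.trans (fun x => if x = u then insert u Q else {x}) ?_ ?_ ?_ ?_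
  · intro x hx y hy
    split_ifs at hy with hxu
    · rcases hy with rfl | hy
      · exact .inl (hxu ▸ hx)
      · exact .inr hy
    · exact .inl (Set.mem_singleton_iff.1 hy ▸ hx)
  · intro x _
    split_ifs with hxu
    · exact (hQ.congr fun r hr s _ hrs => hadj r s hrs hr).insert hp (hadj p u hup hp).symm
    · exact connOn_singleton _ x
  · intro x hx y hy hxy z hz hz'
    have := hSQ z
    split_ifs at hz hz' <;> grind
  · intro x hx y hy hxy
    by_cases he : s(x, y) = s(u, v)
    · rcases Sym2.eq_iff.1 he with ⟨rfl, rfl⟩ | ⟨rfl, rfl⟩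
      · exact ⟨q, by simp [hq], y, by simp [huv.symm], hadj q y hvq hq⟩
      · exact ⟨x, by simp [huv.symm], q, by simp [hq], (hadj q x hvq hq).symm⟩
    · have hmem : ∀ x, x ∈ (if x = u then insert u Q else {x} : Set V) := by
        intro x
        split_ifs with hx
        · exact .inl hx
        · rfl
      exact ⟨x, hmem x, y, hmem y, deleteEdges_adj.2 ⟨hxy, he⟩⟩

/-- The situation of a unique 2-cut `{a, b}` in a 2-connected graph: `C` is a component of the
complement and `R` is the rest, which together with the virtual edge `ab` is nonplanar. -/
structure CutSetup {V : Type} (G : SimpleGraph V) (a b : V) (C R : Set V) : Prop where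
  left_notMem : a ∉ C
  right_notMem : b ∉ C
  mem_rest : ∀ x, x ∈ R ↔ x ∉ C ∧ x ≠ a ∧ x ≠ b
  closed : ∀ x ∈ C, ∀ y, y ≠ a → y ≠ b → G.Adj x y → y ∈ C
  escape : ∀ x y, x ≠ y → x ≠ a → x ≠ b → ∀ D : Set V, D.Nonempty → x ∉ D → y ∉ D →
    ∀ z, z ∉ D → z ≠ x → z ≠ y → ∃ d ∈ D, ∃ q, q ∉ D ∧ q ≠ x ∧ q ≠ y ∧ G.Adj d q
  nonplanarOn : NonplanarOn (G ⊔ edge a b) (R ∪ {a, b})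

namespace CutSetup

variable {V : Type} {G : SimpleGraph V} {a b : V} {C R : Set V}

theorem nonplanarOn_of_link (h : CutSetup G a b C R) (hab : a ≠ b) {G' : SimpleGraph V}
    {S D : Set V} {d : V} (hR : ∀ x, x ∉ C → x ∈ S)
    (hG : ∀ x, x ∉ C → ∀ y, y ∉ C → G.Adj x y → G'.Adj x y) (hD : D ⊆ S)
    (hDC : ∀ x ∈ D, x ∈ C ∨ x = a) (haD : a ∈ D) (hconn : ConnOn G' D) (hd : d ∈ D)
    (hdb : G'.Adj d b) : NonplanarOn G' S := by
  classical
  have hout : ∀ x ∈ R ∪ {a, b}, x ∉ C := by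
    intro x hx
    have := h.mem_rest x
    have := h.left_notMem
    have := h.right_notMem
    grind
  have hmem : ∀ x, x ∈ (if x = a then D else {x} : Set V) := by
    intro x
    split_ifs with hx
    · exact hx ▸ haD
    · rfl
  refine h.nonplanarOn.trans (fun x => if x = a then D else {x}) ?_ ?_ ?_ ?_
  · intro x hx y hy
    split_ifs at hy with hxa
    · exact hD hy
    · exact Set.mem_singleton_iff.1 hy ▸ hR x (hout x hx)
  · intro x _
    split_ifs with hxa
    · exact hconn
    · exact connOn_singleton _ x
  · intro x hx y hy hxy z hz hz'
    have h1 := hDC z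
    have h2 := hout x hx
    have h3 := hout y hy
    split_ifs at hz hz' <;> grind
  · intro x hx y hy hxy
    rcases sup_edge_adj.1 hxy with hxy | ⟨⟨rfl, rfl⟩ | ⟨rfl, rfl⟩, -⟩
    · exact ⟨x, hmem x, y, hmem y, hG x (hout x hx) y (hout y hy) hxy⟩
    · exact ⟨d, by simpa using hd, y, hmem y, hdb⟩
    · exact ⟨x, hmem x, d, by simpa using hd, hdb.symm⟩

theorem not_separated_by_vertex (h : CutSetup G a b C R) (hab : a ≠ b) {w c : V} {D : Set V}
    (hw : w ∈ C) (hc : c ∈ C) (hcw : c ≠ w) (haD : a ∈ D) (hDC : ∀ x ∈ D, x ∈ C ∨ x = a)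
    (hwD : w ∉ D) (hcl : ∀ p ∈ D, ∀ q ∈ C, q ≠ w → G.Adj p q → q ∈ D)
    (hb : ∀ p ∈ D, ¬ G.Adj p b) : False := by
  have haC := h.left_notMem
  have hbC := h.right_notMem
  have hwa : w ≠ a := fun he => haC (he ▸ hw)
  have hwb : w ≠ b := fun he => hbC (he ▸ hw)
  have hbD : b ∉ D := fun hbD => (hDC b hbD).elim hbC hab.symm
  have hDa : ∀ x ∈ D, x = a := by
    by_contra! hn
    obtain ⟨x, hx, hxa⟩ := hn
    obtain ⟨d, hd, q, hq, hqw, hqa, hadj⟩ := h.escape w a hwa hwa hwb (D \ {a}) ⟨x, hx, hxa⟩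
      (fun h => hwD h.1) (fun h => h.2 rfl) b (fun h => hbD h.1) hwb.symm hab.symm
    have hdC : d ∈ C := (hDC d hd.1).resolve_right hd.2
    by_cases hqb : q = b
    · exact hb d hd.1 (hqb ▸ hadj)
    · exact hq ⟨hcl d hd.1 q (h.closed d hdC q hqa hqb hadj) hqw hadj, hqa⟩
  obtain ⟨d, hd, q, hq, hqw, hqb, hadj⟩ := h.escape w b hwb hwa hwb (C \ {w}) ⟨c, hc, hcw⟩
    (fun h => h.2 rfl) (fun h => hbC h.1) a (fun h => haC h.1) hwa.symm hab
  by_cases hqa : q = a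
  · exact haC (hDa d (hcl a haD d hd.1 hd.2 (hqa ▸ hadj.symm)) ▸ hd.1)
  · exact hq ⟨h.closed d hd.1 q hqa hqb hadj, hqw⟩

theorem deleteEdges_nonplanarOn (h : CutSetup G a b C R) (hab : a ≠ b) {u v : V} (huv : u ≠ v)
    (hu : u ∈ C) (hv : v ∈ C) {D Sa Sb : Set V} (haD : a ∈ D)
    (hDC : ∀ x ∈ D, x ∈ C ∨ x = a) (huD : u ∉ D) (hvD : v ∉ D) (hD : ConnOn G D)
    (hcl : ∀ p ∈ D, ∀ q ∈ C, q ≠ u → q ≠ v → G.Adj p q → q ∈ D) (hb : ∀ p ∈ D, ¬ G.Adj p b)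
    (hSa : KuratowskiOn G Sa u v) (hSb : KuratowskiOn G Sb u v)
    (hSaC : ∀ x ∈ Sa, x ∈ C ∨ x = b) (hSbC : ∀ x ∈ Sb, x ∈ C ∨ x = a)
    (hbSa : b ∈ Sa) (haSb : a ∈ Sb) (w : V) :
    NonplanarOn (G.deleteEdges {s(u, v)}) {w}ᶜ := by
  by_contra hn
  have haC := h.left_notMem
  have hbC := h.right_notMem
  have hua : u ≠ a := fun he => haC (he ▸ hu)
  have hub : u ≠ b := fun he => hbC (he ▸ hu)
  have hva : v ≠ a := fun he => haC (he ▸ hv)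
  have hvb : v ≠ b := fun he => hbC (he ▸ hv)
  have hbD : b ∉ D := fun hbD => (hDC b hbD).elim hbC hab.symm
  have hSaD : ∀ x ∈ Sa, x ≠ u → x ≠ v → x ∉ D := by
    intro x hx hxu hxv
    refine hSa.conn_two.2 (· ∉ D) b ⟨hbSa, by simp [hub.symm, hvb.symm]⟩ hbD ?_ x
      ⟨hx, by simp [hxu, hxv]⟩
    intro p hp q hq hpq hpD hqD
    simp only [Set.mem_sdiff, Set.mem_insert_iff, Set.mem_singleton_iff, not_or] at hp
    rcases hSaC p hp.1 with hpC | rfl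
    · exact hpD (hcl q hqD p hpC hp.2.1 hp.2.2 hpq.symm)
    · exact hb q hqD hpq.symm
  have hSbD : ∀ x ∈ Sb, x ≠ u → x ≠ v → x ∈ D := by
    intro x hx hxu hxv
    refine hSb.conn_two.2 (· ∈ D) a ⟨haSb, by simp [hua.symm, hva.symm]⟩ haD ?_ x
      ⟨hx, by simp [hxu, hxv]⟩
    intro p hp q hq hpq hpD
    simp only [Set.mem_sdiff, Set.mem_insert_iff, Set.mem_singleton_iff, not_or] at hq
    rcases hSbC q hq.1 with hqC | rfl
    · exact hcl p hpD q hqC hq.2.1 hq.2.2 hpq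
    · exact haD
  let Ends : V → V → Prop := fun s t => s = u ∧ t = v ∨ s = v ∧ t = u
  have nbr : ∀ {S : Set V} {c : V}, KuratowskiOn G S u v → c ∈ S → c ≠ u → c ≠ v →
      ∀ s t, Ends s t → ∃ y ∈ S, y ≠ u ∧ y ≠ v ∧ G.Adj s y := by
    intro S c hS hc hcu hcv s t hst
    have hs : s ∈ S ∧ s ≠ t ∧ c ≠ t ∧ c ≠ s := by
      rcases hst with ⟨rfl, rfl⟩ | ⟨rfl, rfl⟩
      · exact ⟨hS.left_mem, huv, hcv, hcu⟩
      · exact ⟨hS.right_mem, huv.symm, hcu, hcv⟩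
    by_contra! hno
    refine hs.2.2.2 ((hS.conn_one t).2 (fun y => y = s) s ⟨hs.1, hs.2.1⟩ rfl ?_ c
      ⟨hc, hs.2.2.1⟩)
    rintro p hp q hq hpq rfl
    by_contra hqp
    have hqt : q ≠ t := hq.2
    refine hno q hq.1 ?_ ?_ hpq <;> rcases hst with ⟨rfl, rfl⟩ | ⟨rfl, rfl⟩ <;> assumption
  have keep : ∀ p q, G.Adj p q → (p ≠ u ∧ p ≠ v ∨ q ≠ u ∧ q ≠ v) →
      (G.deleteEdges {s(u, v)}).Adj p q := by
    intro p q hpq hne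
    refine deleteEdges_adj.2 ⟨hpq, fun he => ?_⟩
    rcases Sym2.eq_iff.1 (Set.mem_singleton_iff.1 he) with ⟨rfl, rfl⟩ | ⟨rfl, rfl⟩ <;> simp at hne
  by_cases hw : w ∈ C
  · have hwa : w ≠ a := fun he => haC (he ▸ hw)
    obtain ⟨E, hEsub, haE, hE, hEcl⟩ := exists_component (G.deleteEdges {s(u, v)})
      {x | (x ∈ C ∨ x = a) ∧ x ≠ w} (x := a) ⟨.inr rfl, hwa.symm⟩
    have hbE : ∀ p ∈ E, ¬ G.Adj p b := by
      intro p hp hpb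
      refine hn (h.nonplanarOn_of_link hab (fun x hx hxw => hx (hxw ▸ hw)) ?_
        (fun x hx => (hEsub hx).2) (fun x hx => (hEsub hx).1) haE hE hp
        (keep p b hpb (.inr ⟨hub.symm, hvb.symm⟩)))
      exact fun x hx y _ hxy => keep x y hxy
        (.inl ⟨fun he => hx (he ▸ hu), fun he => hx (he ▸ hv)⟩)
    have cross : ∀ s t, Ends s t → s ∈ E → t ∉ E → t ≠ w → False := by
      intro s t hst hs ht htw
      have hsw : s ≠ w := (hEsub hs).2
      have hwuv : w ≠ u ∧ w ≠ v := by
        rcases hst with ⟨rfl, rfl⟩ | ⟨rfl, rfl⟩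
        · exact ⟨hsw.symm, htw.symm⟩
        · exact ⟨htw.symm, hsw.symm⟩
      by_cases hwD : w ∈ D
      · obtain ⟨y, hy, hyu, hyv, hsy⟩ := nbr hSa hbSa hub.symm hvb.symm s t hst
        have hyD := hSaD y hy hyu hyv
        rcases hSaC y hy with hyC | rfl
        swap
        · exact hbE s hs hsy
        have hyE : y ∈ E := hEcl s hs y ⟨.inl hyC, fun he => hyD (he ▸ hwD)⟩
          (keep s y hsy (.inr ⟨hyu, hyv⟩))
        obtain ⟨d, hd, q, hq, hqu, hqv, hadj⟩ := h.escape u v huv hua hub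
          {x | x ∈ E ∧ x ∉ D ∧ x ≠ u ∧ x ≠ v} ⟨y, hyE, hyD, hyu, hyv⟩
          (fun h => h.2.2.1 rfl) (fun h => h.2.2.2 rfl) a (fun h => h.2.1 haD) hua.symm hva.symm
        have hdC : d ∈ C := (hEsub hd.1).1.resolve_right fun he => hd.2.1 (he ▸ haD)
        have hqD : q ∉ D := fun hqD => hd.2.1 (hcl q hqD d hdC hd.2.2.1 hd.2.2.2 hadj.symm)
        have hqb : q ≠ b := by rintro rfl; exact hbE d hd.1 hadj
        have hqa : q ≠ a := by rintro rfl; exact hqD haD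
        have hqC := h.closed d hdC q hqa hqb hadj
        exact hq ⟨hEcl d hd.1 q ⟨.inl hqC, fun he => hqD (he ▸ hwD)⟩
          (keep d q hadj (.inr ⟨hqu, hqv⟩)), hqD, hqu, hqv⟩
      · have hDE : ∀ x ∈ D, x ∈ E := hD.2 (· ∈ E) a haD haE fun p _ q hq hpq hpE =>
          hEcl p hpE q ⟨hDC q hq, fun he => hwD (he ▸ hq)⟩
            (keep p q hpq (.inr ⟨fun he => huD (he ▸ hq), fun he => hvD (he ▸ hq)⟩))
        have hts : Ends t s := hst.symm.imp And.symm And.symm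
        obtain ⟨y, hy, hyu, hyv, hty⟩ := nbr hSb haSb hua.symm hva.symm t s hts
        have htC : t ∈ C := by rcases hst with ⟨-, rfl⟩ | ⟨-, rfl⟩ <;> assumption
        exact ht (hEcl y (hDE y (hSbD y hy hyu hyv)) t ⟨.inl htC, htw⟩
          (keep y t hty.symm (.inl ⟨hyu, hyv⟩)))
    obtain ⟨c, hc, hcw⟩ : ∃ c ∈ C, c ≠ w := by
      by_cases huw : u = w
      · exact ⟨v, hv, fun he => huv (huw.trans he.symm)⟩
      · exact ⟨u, hu, huw⟩
    refine h.not_separated_by_vertex hab hw hc hcw haE (fun x hx => (hEsub hx).1)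
      (fun h => (hEsub h).2 rfl) (fun p hp q hq hqw hpq => ?_) hbE
    by_cases he : s(p, q) = s(u, v)
    · by_contra hqE
      exact cross p q (Sym2.eq_iff.1 he) hp hqE hqw
    · exact hEcl p hp q ⟨.inl hq, hqw⟩ (deleteEdges_adj.2 ⟨hpq, he⟩)
  by_cases hwb : w = b
  · subst hwb
    obtain ⟨y, hy, hyb, hyu, hyv⟩ := hSa.four w u v
    obtain ⟨Q, hQsub, hyQ, hQ, hQcl⟩ := exists_component G
      {x | x ∈ C ∧ x ∉ D ∧ x ≠ u ∧ x ≠ v} (x := y)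
      ⟨(hSaC y hy).resolve_right hyb, hSaD y hy hyu hyv, hyu, hyv⟩
    have touch : ∀ s t, Ends s t → ∃ q ∈ Q, G.Adj q t := by
      intro s t hst
      have hs : s ≠ w ∧ s ≠ a ∧ s ∉ Q := by
        rcases hst with ⟨rfl, -⟩ | ⟨rfl, -⟩
        · exact ⟨hub, hua, fun h => (hQsub h).2.2.1 rfl⟩
        · exact ⟨hvb, hva, fun h => (hQsub h).2.2.2 rfl⟩
      obtain ⟨d, hd, q, hq, hqs, hqb, hadj⟩ := h.escape s w hs.1 hs.2.1 hs.1 Q ⟨y, hyQ⟩ hs.2.2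
        (fun h => hbC (hQsub h).1) a (fun h => (hQsub h).2.1 haD) hs.2.1.symm hab
      obtain ⟨hdC, hdD, hdu, hdv⟩ := hQsub hd
      have hqD : q ∉ D := fun hqD => hdD (hcl q hqD d hdC hdu hdv hadj.symm)
      have hqa : q ≠ a := by rintro rfl; exact hqD haD
      have hqC := h.closed d hdC q hqa hqb hadj
      refine ⟨d, hd, ?_⟩
      by_cases hqt : q = t
      · exact hqt ▸ hadj
      · exact absurd (hQcl d hd q ⟨hqC, hqD, by grind, by grind⟩ hadj) hq
    obtain ⟨p, hp, hpu⟩ := touch v u (.inr ⟨rfl, rfl⟩)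
    obtain ⟨q, hq, hqv⟩ := touch u v (.inl ⟨rfl, rfl⟩)
    refine hn ((hSb.nonplanarOn.detour huv hQ (fun x hx hxS => ?_)
      (fun h => (hQsub h).2.2.1 rfl) (fun h => (hQsub h).2.2.2 rfl) hp hpu hq hqv).mono ?_
      fun _ _ _ _ => id)
    · exact (hQsub hx).2.1 (hSbD x hxS (hQsub hx).2.2.1 (hQsub hx).2.2.2)
    · rintro x (hx | hx) rfl
      · exact (hSbC _ hx).elim hbC hab.symm
      · exact hbC (hQsub hx).1
  · obtain ⟨y, hy, hya, hyu, hyv⟩ := hSb.four a u v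
    obtain ⟨Q, hQsub, hyQ, hQ, hQcl⟩ := exists_component G (D \ {a}) (x := y)
      ⟨hSbD y hy hyu hyv, hya⟩
    have hQuv : ∀ x ∈ Q, x ≠ u ∧ x ≠ v := fun x hx =>
      ⟨fun he => huD (he ▸ (hQsub hx).1), fun he => hvD (he ▸ (hQsub hx).1)⟩
    have touch : ∀ s t, Ends s t → ∃ q ∈ Q, G.Adj q t := by
      intro s t hst
      have hs : s ≠ b ∧ s ≠ a ∧ s ∉ Q := by
        rcases hst with ⟨rfl, -⟩ | ⟨rfl, -⟩
        · exact ⟨hub, hua, fun h => (hQuv _ h).1 rfl⟩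
        · exact ⟨hvb, hva, fun h => (hQuv _ h).2 rfl⟩
      obtain ⟨d, hd, q, hq, hqs, hqa, hadj⟩ := h.escape s a hs.2.1 hs.2.1 hs.1 Q ⟨y, hyQ⟩ hs.2.2
        (fun h => (hQsub h).2 rfl) b (fun h => hbD (hQsub h).1) hs.1.symm hab.symm
      obtain ⟨hdD, hda⟩ := hQsub hd
      have hqb : q ≠ b := by rintro rfl; exact hb d hdD hadj
      have hqC := h.closed d ((hDC d hdD).resolve_right hda) q hqa hqb hadj
      refine ⟨d, hd, ?_⟩
      by_cases hqt : q = t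
      · exact hqt ▸ hadj
      · exact absurd (hQcl d hd q ⟨hcl d hdD q hqC (by grind) (by grind) hadj, hqa⟩ hadj) hq
    obtain ⟨p, hp, hpu⟩ := touch v u (.inr ⟨rfl, rfl⟩)
    obtain ⟨q, hq, hqv⟩ := touch u v (.inl ⟨rfl, rfl⟩)
    refine hn ((hSa.nonplanarOn.detour huv hQ (fun x hx hxS => ?_)
      (fun h => (hQuv _ h).1 rfl) (fun h => (hQuv _ h).2 rfl) hp hpu hq hqv).mono ?_
      fun _ _ _ _ => id)
    · exact hSaD x hxS (hQuv x hx).1 (hQuv x hx).2 (hQsub hx).1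
    · rintro x (hx | hx) rfl
      · exact (hSaC _ hx).elim hw hwb
      · exact hw ((hDC _ (hQsub hx).1).resolve_right (hQsub hx).2)

/-- If contracting `uv` and deleting `w` makes the graph planar, then `u` and `v` separate `a`
from `b`: the set `D` is the component of `a` avoiding `u` and `v`. -/
theorem exists_separated (h : CutSetup G a b C R) (hab : a ≠ b) {u v w : V} (huv : u ≠ v)
    (hu : u ∈ C) (hv : v ∈ C) (hw : w ∈ C) (hwv : w ≠ v)
    (hn : ¬ NonplanarOn (contractEdge G u v) ({v}ᶜ \ {w})) :
    ∃ D : Set V, a ∈ D ∧ (∀ x ∈ D, x ∈ C ∨ x = a) ∧ u ∉ D ∧ v ∉ D ∧ ConnOn G D ∧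
      (∀ p ∈ D, ∀ q ∈ C, q ≠ u → q ≠ v → G.Adj p q → q ∈ D) ∧ ∀ p ∈ D, ¬ G.Adj p b := by
  have haC := h.left_notMem
  have hbC := h.right_notMem
  have ha : contractMap u v a = a := if_neg (fun he : a = v => haC (he ▸ hv))
  have hb : contractMap u v b = b := if_neg (fun he : b = v => hbC (he ▸ hv))
  have hmapC : ∀ x, x ∈ C ∨ x = a → contractMap u v x ∈ C ∨ contractMap u v x = a := by
    intro x hx
    simp only [contractMap]
    grind
  have hmapv : ∀ x, contractMap u v x ≠ v := by
    intro x
    simp only [contractMap]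
    grind
  have hwa : w ≠ a := fun he => haC (he ▸ hw)
  obtain ⟨D, hDsub, haD, hD, hDcl⟩ := exists_component G
    {x | (x ∈ C ∨ x = a) ∧ contractMap u v x ≠ w} (x := a) ⟨.inr rfl, by rw [ha]; exact hwa.symm⟩
  have hbD : ∀ p ∈ D, ¬ G.Adj p b := by
    intro p hp hpb
    refine hn (h.nonplanarOn_of_link hab (D := contractMap u v '' D) (d := contractMap u v p)
      ?_ ?_ ?_ ?_ ⟨a, haD, ha⟩
      (hD.image _ fun p _ q _ hpq => contractMap_adj huv hpq) ⟨p, hp, rfl⟩ ?_)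
    · exact fun x hx => ⟨fun he => hx (Set.mem_singleton_iff.1 he ▸ hv),
        fun he => hx (Set.mem_singleton_iff.1 he ▸ hw)⟩
    · exact fun x hx y hy hxy => contractEdge_adj.2 ⟨hxy.ne, fun he => hx (he ▸ hv),
        fun he => hy (he ▸ hv), .inl hxy⟩
    · rintro _ ⟨x, hx, rfl⟩
      exact ⟨hmapv x, (hDsub hx).2⟩
    · rintro _ ⟨x, hx, rfl⟩
      exact hmapC x (hDsub hx).1
    · have := contractMap_adj huv hpb
      rw [hb] at this
      refine this.resolve_left fun he => ?_
      have := hmapC p (hDsub hp).1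
      rw [he] at this
      exact this.elim hbC hab.symm
  have hmap : ∀ x, x ≠ u → x ≠ v → contractMap u v x = x := fun x _ hx => if_neg hx
  by_cases hwu : w = u
  · subst hwu
    refine ⟨D, haD, fun x hx => (hDsub hx).1, fun hx => (hDsub hx).2 (if_neg huv),
      fun hx => (hDsub hx).2 (if_pos rfl), hD, ?_, hbD⟩
    exact fun p hp q hq hqu hqv hpq => hDcl p hp q ⟨.inl hq, by rwa [hmap q hqu hqv]⟩ hpq
  · refine (h.not_separated_by_vertex hab hw hu (Ne.symm hwu) haD (fun x hx => (hDsub hx).1)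
      (fun hx => (hDsub hx).2 (if_neg hwv)) (fun p hp q hq hqw hpq => ?_) hbD).elim
    refine hDcl p hp q ⟨.inl hq, ?_⟩ hpq
    simp only [contractMap]
    grind

end CutSetup

theorem connOn_compl_singleton {V : Type} [Fintype V] {G : SimpleGraph V} (hk : vConn G = 2)
    (x : V) : ConnOn G {x}ᶜ := by
  have hmem : vConn G ∈ {k : ℕ | ∀ s : Finset V, s.card < k →
      (G.induce ((↑s : Set V)ᶜ)).Connected} := by
    refine Nat.sSup_mem ⟨0, fun s hs => absurd hs (Nat.not_lt_zero _)⟩ ?_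
    by_contra hb
    have : vConn G = 0 := csSup_of_not_bddAbove hb |>.trans csSup_empty
    omega
  rw [hk] at hmem
  simpa using connected_induce_iff_connOn.1 (hmem {x} (by simp))

namespace CutSetup

variable {V : Type} {G : SimpleGraph V} {a b : V} {C L : Set V}

theorem exists_escape_of_isTwoCut_unique (huniq : ∀ T : Set V, IsTwoCut G T → T = ({a, b} : Set V))
    {x y : V} (hxy : x ≠ y) (hxa : x ≠ a) (hxb : x ≠ b) {D : Set V} (hD : D.Nonempty)
    (hxD : x ∉ D) (hyD : y ∉ D) {z : V} (hzD : z ∉ D) (hzx : z ≠ x) (hzy : z ≠ y) :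
    ∃ d ∈ D, ∃ q, q ∉ D ∧ q ≠ x ∧ q ≠ y ∧ G.Adj d q := by
  have hpre : (G.induce ({x, y} : Set V)ᶜ).Preconnected := by
    by_contra hn
    have hx : x ∈ ({a, b} : Set V) := huniq {x, y} ⟨Set.ncard_pair hxy, hn⟩ ▸ .inl rfl
    exact hx.elim hxa hxb
  by_contra! hno
  obtain ⟨d, hd⟩ := hD
  refine hzD (hpre.induce_closed (· ∈ D) (x := d) ?_ hd ?_ (y := z) (by simp [hzx, hzy]))
  · simp only [Set.mem_compl_iff, Set.mem_insert_iff, Set.mem_singleton_iff, not_or]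
    exact ⟨fun he => hxD (he ▸ hd), fun he => hyD (he ▸ hd)⟩
  · intro p _ q hq hpq hp
    simp only [Set.mem_compl_iff, Set.mem_insert_iff, Set.mem_singleton_iff, not_or] at hq
    by_contra hqD
    exact hno p hp q hqD hq.1 hq.2 hpq

theorem exists_adj_of_isCompOf (hL : IsCompOf G {a, b} L) (hconn : ConnOn G {b}ᶜ) (hab : a ≠ b) :
    ∃ l ∈ L, G.Adj l a := by
  obtain ⟨⟨l, hl⟩, hdL, -, hcl⟩ := hL
  have haL : a ∉ L := fun h => Set.disjoint_left.1 hdL h (.inl rfl)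
  by_contra! hno
  refine haL (hconn.2 (· ∈ L) l (fun he => Set.disjoint_left.1 hdL hl (.inr he)) hl ?_ a hab)
  intro p _ q hq hpq hp
  refine hcl p hp q ?_ hpq
  rintro (rfl | rfl)
  · exact hno p hp hpq
  · exact hq rfl

theorem of_isHeavyComp [Fintype V] (hobs : IsApexObstruction G) (hk : vConn G = 2)
    (huniq : ∀ T : Set V, IsTwoCut G T → T = ({a, b} : Set V)) (hab : a ≠ b)
    (hheavy : IsHeavyComp G a b C) (hlight : IsCompOf G {a, b} L) (hLC : L ≠ C) :
    CutSetup G a b C (C ∪ {a, b})ᶜ := by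
  classical
  obtain ⟨⟨hC0, hdC, hCconn, hCcl⟩, ⟨Ka, hKa, hKaC⟩, Kb, hKb, hKbC⟩ := hheavy
  have haC : a ∉ C := fun h => Set.disjoint_left.1 hdC h (.inl rfl)
  have hbC : b ∉ C := fun h => Set.disjoint_left.1 hdC h (.inr rfl)
  have haL : a ∉ L := fun h => Set.disjoint_left.1 hlight.2.1 h (.inl rfl)
  have hbL : b ∉ L := fun h => Set.disjoint_left.1 hlight.2.1 h (.inr rfl)
  have hCc := connected_induce_iff_connOn.1 hCconn
  have hLc := connected_induce_iff_connOn.1 hlight.2.2.1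
  have hLC' : ∀ x ∈ L, x ∉ C := by
    intro x hxL hxC
    refine hLC (Set.Subset.antisymm ?_ ?_)
    · exact hLc.2 (· ∈ C) x hxL hxC fun p _ q hq hpq hp =>
        hCcl p hp q (Set.disjoint_left.1 hlight.2.1 hq) hpq
    · exact hCc.2 (· ∈ L) x hxC hxL fun p _ q hq hpq hp =>
        hlight.2.2.2 p hp q (Set.disjoint_left.1 hdC hq) hpq
  obtain ⟨la, hla, hadja⟩ := exists_adj_of_isCompOf hlight (connOn_compl_singleton hk b) hab
  obtain ⟨lb, hlb, hadjb⟩ := exists_adj_of_isCompOf (Set.pair_comm a b ▸ hlight)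
    (connOn_compl_singleton hk a) hab.symm
  have : Nonempty V := ⟨a⟩
  have hmem : ∀ x, x ∈ (if x = a then insert a L else {x} : Set V) := by
    intro x
    split_ifs with hx
    · exact .inl hx
    · rfl
  obtain ⟨w, hw⟩ := IsApexObstruction.exists_apex_of_ssubset (H := G ⊔ edge a b) hobs
    (S := C ∪ {a, b}) (fun he => by
      have : la ∈ C ∪ {a, b} := he ▸ Set.mem_univ la
      rcases this with h | rfl | rfl
      · exact hLC' _ hla h
      · exact haL hla
      · exact hbL hla)
    (fun x => if x = a then insert a L else {x}) (fun x _ => by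
      split_ifs with hx
      · exact hLc.insert hla hadja.symm
      · exact connOn_singleton _ x) (fun x hx y hy hxy z hz hz' => by
      have := hLC' z
      split_ifs at hz hz' <;> grind) (fun x hx y hy hxy => by
      rcases sup_edge_adj.1 hxy with hxy | ⟨⟨rfl, rfl⟩ | ⟨rfl, rfl⟩, -⟩
      · exact ⟨x, hmem x, y, hmem y, hxy⟩
      · exact ⟨lb, by simp [hlb], y, hmem y, hadjb⟩
      · exact ⟨x, hmem x, lb, by simp [hlb], hadjb.symm⟩)
  have avoid : ∀ {K : G.Subgraph}, IsKuratowski K → K.verts ⊆ C ∪ {a, b} → w ∈ K.verts := by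
    intro K hK hKC
    by_contra hwK
    exact hw (hK.nonplanarOn.mono (fun x hx => ⟨hKC hx, fun he => hwK (he ▸ hx)⟩)
      fun _ _ _ _ h => sup_edge_adj.2 (.inl h))
  have hwa : w ≠ a := fun he => hKa.2 (he ▸ avoid hKa.1 hKaC)
  have hwb : w ≠ b := fun he => hKb.2 (he ▸ avoid hKb.1 hKbC)
  have hwC : w ∈ C := (hKaC (avoid hKa.1 hKaC)).resolve_right fun h => h.elim hwa hwb
  have hclosed : ∀ x ∈ C, ∀ y, y ≠ a → y ≠ b → G.Adj x y → y ∈ C :=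
    fun x hx y hya hyb hxy => hCcl x hx y (fun h => h.elim hya hyb) hxy
  refine ⟨haC, hbC, fun x => by simp; tauto, hclosed, ?_, ?_⟩
  · exact fun x y hxy hxa hxb D hD hxD hyD z hzD hzx hzy =>
      exists_escape_of_isTwoCut_unique huniq hxy hxa hxb hD hxD hyD hzD hzx hzy
  · have hsum : NonplanarOn G ((C \ {w}) ∪ (C ∪ {a, b})ᶜ ∪ {a, b}) := by
      refine (nonplanarOn_compl_of_not_isApex hobs.1 w).mono (fun x hx => ?_) fun _ _ _ _ => id
      simp only [Set.mem_compl_iff, Set.mem_singleton_iff] at hx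
      simp only [Set.mem_union, Set.mem_sdiff, Set.mem_singleton_iff, Set.mem_compl_iff,
        Set.mem_insert_iff]
      tauto
    refine (hsum.two_sum (fun x hx y hy hxy => ?_) ?_ hab).resolve_left fun h => hw ?_
    · exact hy (.inl (hclosed x hx.1 y (fun h => hy (.inr (.inl h)))
        (fun h => hy (.inr (.inr h))) hxy))
    · exact Set.disjoint_left.2 fun x hx hx' => hx' (.inl hx.1)
    · refine h.mono (fun x hx => ?_) fun _ _ _ _ => id
      simp only [Set.mem_union, Set.mem_sdiff, Set.mem_singleton_iff, Set.mem_insert_iff] at hx ⊢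
      grind

end CutSetup

/-- Contracting an edge `uv` of an apex obstruction gives an apex graph. -/
theorem IsApexObstruction.exists_apex_contractEdge {V : Type} [Fintype V] {G : SimpleGraph V}
    (hobs : IsApexObstruction G) {u v : V} (huv : G.Adj u v) :
    ∃ w, ¬ NonplanarOn (contractEdge G u v) ({v}ᶜ \ {w}) := by
  classical
  have : Nonempty V := ⟨u⟩
  have hmem : ∀ x, x ∈ (if x = u then {u, v} else {x} : Set V) := by
    intro x
    split_ifs with hx
    · exact .inl hx
    · rfl
  refine IsApexObstruction.exists_apex_of_ssubset hobs
    (fun he => (he ▸ Set.mem_univ v : v ∈ ({v}ᶜ : Set V)) rfl)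
    (fun x => if x = u then {u, v} else {x}) ?_ ?_ ?_
  · intro x _
    split_ifs with hx
    · exact (connOn_singleton G v).insert rfl huv
    · exact connOn_singleton G x
  · intro x hx y hy hxy z hz hz'
    split_ifs at hz hz' <;> grind
  · intro x _ y _ hxy
    rcases (contractEdge_adj.1 hxy).2.2.2 with h | ⟨rfl, h⟩ | ⟨rfl, h⟩
    · exact ⟨x, hmem x, y, hmem y, h⟩
    · exact ⟨v, by simp, y, hmem y, h⟩
    · exact ⟨x, hmem x, v, by simp, h⟩

theorem ConnOn.subset_or_disjoint {V : Type} {G : SimpleGraph V} {a b : V} {C R S : Set V}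
    (h : CutSetup G a b C R) (hS : ConnOn G (S \ {b})) (haS : a ∉ S) :
    (∀ x ∈ S, x ∈ C ∨ x = b) ∨ ∀ x ∈ S, x ∉ C := by
  by_cases hex : ∃ x ∈ S, x ∈ C
  · obtain ⟨x, hx, hxC⟩ := hex
    refine .inl fun y hy => or_iff_not_imp_right.2 fun hyb => ?_
    refine hS.2 (· ∈ C) x ⟨hx, fun he => h.right_notMem (he ▸ hxC)⟩ hxC ?_ y ⟨hy, hyb⟩
    exact fun p _ q hq hpq hp => h.closed p hp q (fun he => haS (he ▸ hq.1)) hq.2 hpq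
  · exact .inr fun x hx hxC => hex ⟨x, hx, hxC⟩

theorem CutSetup.symm {V : Type} {G : SimpleGraph V} {a b : V} {C R : Set V}
    (h : CutSetup G a b C R) : CutSetup G b a C R where
  left_notMem := h.right_notMem
  right_notMem := h.left_notMem
  mem_rest x := by rw [h.mem_rest, and_comm (a := x ≠ a)]
  closed x hx y hyb hya := h.closed x hx y hya hyb
  escape x y hxy hxb hxa := h.escape x y hxy hxa hxb
  nonplanarOn := by rw [edge_comm, Set.pair_comm]; exact h.nonplanarOn

end SimpleGraph

/-- An edge shared by Kuratowski subgraphs avoiding `a` and `b` has both endpoints branch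
vertices of one of them. -/
theorem shared_edge_branch_vertices {V : Type} [Fintype V] (G : SimpleGraph V) (a b : V) (C L : Set V)
    (hobs : IsApexObstruction G)
    (hk : vConn G = 2)
    (hcut : IsTwoCut G {a, b})
    (huniq : ∀ T : Set V, IsTwoCut G T → T = ({a, b} : Set V))
    (hab : a ≠ b)
    (hheavy : IsHeavyComp G a b C)
    (hlight : IsCompOf G {a, b} L) (hLC : L ≠ C)
    (hplanarC : IsPlanar (G.induce C))
    (Ha Hb : G.Subgraph)
    (hHa : IsKuratowskiWitness G a Ha) (hHb : IsKuratowskiWitness G b Hb)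
    (u v : V) (huv : Ha.Adj u v) (huv' : Hb.Adj u v) :
    (IsBranchVertex Ha u ∧ IsBranchVertex Ha v) ∨
      (IsBranchVertex Hb u ∧ IsBranchVertex Hb v) := by
  by_contra hn
  rw [not_or] at hn
  have hG := Ha.adj_sub huv
  have hSa := hHa.1.kuratowskiOn huv hn.1
  have hSb := hHb.1.kuratowskiOn huv' hn.2
  have setup := CutSetup.of_isHeavyComp hobs hk huniq hab hheavy hlight hLC
  obtain ⟨w, hw⟩ := IsApexObstruction.exists_apex_contractEdge hobs hG
  have avoid : ∀ {S : Set V}, NonplanarOn (contractEdge G u v) (S \ {v}) → w ∈ S ∧ w ≠ v := by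
    intro S hS
    by_contra hwS
    exact hw (hS.mono (fun x hx => ⟨hx.2, fun he => hwS ⟨he ▸ hx.1, he ▸ hx.2⟩⟩)
      fun _ _ _ _ => id)
  obtain ⟨hwSa, hwv⟩ := avoid hSa.contract
  obtain ⟨hwSb, -⟩ := avoid hSb.contract
  have hSaC : ∀ x ∈ Ha.verts, x ∈ C ∨ x = b := by
    refine ((hSa.conn_one b).subset_or_disjoint setup hHa.2).resolve_right fun hdisj => ?_
    obtain ⟨-, ⟨K, hK, hKC⟩, -⟩ := hheavy
    have hout : ∀ x ∈ Ha.verts, x ∈ K.verts → x = b := by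
      intro x hx hxK
      rcases hKC hxK with h | rfl | rfl
      · exact absurd h (hdisj x hx)
      · exact absurd hxK hK.2
      · rfl
    have hne : ∀ x ∈ Hb.verts, x ≠ b := fun x hx he => hHb.2 (he ▸ hx)
    have hvK : v ∉ K.verts := fun h => hne v hSb.right_mem (hout v hSa.right_mem h)
    have hwK : w ∉ K.verts := fun h => hne w hwSb (hout w hwSa h)
    refine hw (hK.1.nonplanarOn.mono (fun x hx => ⟨fun he => hvK (he ▸ hx),
      fun he => hwK (he ▸ hx)⟩) fun x hx y hy hxy => ?_)
    exact contractEdge_adj.2 ⟨hxy.ne, fun he => hvK (he ▸ hx), fun he => hvK (he ▸ hy), .inl hxy⟩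
  have inC : ∀ x ∈ Ha.verts, x ∈ Hb.verts → x ∈ C := fun x hx hx' =>
    (hSaC x hx).resolve_right fun he => hHb.2 (he ▸ hx')
  have huC := inC u hSa.left_mem hSb.left_mem
  have hvC := inC v hSa.right_mem hSb.right_mem
  have hSbC : ∀ x ∈ Hb.verts, x ∈ C ∨ x = a :=
    ((hSb.conn_one a).subset_or_disjoint setup.symm hHb.2).resolve_right
      fun hdisj => hdisj u hSb.left_mem huC
  rw [isPlanar_induce_iff] at hplanarC
  have hbSa : b ∈ Ha.verts := by
    by_contra hb
    exact hplanarC (hSa.nonplanarOn.mono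
      (fun x hx => (hSaC x hx).resolve_right fun he => hb (he ▸ hx)) fun _ _ _ _ => id)
  have haSb : a ∈ Hb.verts := by
    by_contra ha
    exact hplanarC (hSb.nonplanarOn.mono
      (fun x hx => (hSbC x hx).resolve_right fun he => ha (he ▸ hx)) fun _ _ _ _ => id)
  obtain ⟨D, haD, hDC, huD, hvD, hD, hcl, hb⟩ :=
    setup.exists_separated hab hG.ne huC hvC (inC w hwSa hwSb) hwv hw
  have : Nonempty V := ⟨a⟩
  obtain ⟨w', hw'⟩ := IsApexObstruction.exists_apex_deleteEdge hobs hG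
  exact hw' (setup.deleteEdges_nonplanarOn hab hG.ne huC hvC haD hDC huD hvD hD hcl hb hSa hSb
    hSaC hSbC hbSa haSb w')
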